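/- If M is an atomic model of S_α and A is a finite substructure of M, then A ≤ M if and only if δ(A) = 0. -/

import Mathlib

open Finset

/-- The number of subsets of `A` on which the relation `E` holds. -/
noncomputable def edgeCount {L V : Type} (rel : L → Finset V → Prop) (E : L)
    (A : Finset V) : ℕ :=
  {e : Finset V | e ⊆ A ∧ rel E e}.ncard

/-- The rank function `δ(A) = |A| - ∑_E α_E · N_E(A)`. -/
noncomputable def delta {L V : Type} [Fintype L] (α : L → ℝ)
    (rel : L → Finset V → Prop) (A : Finset V) : ℝ :=
  (A.card : ℝ) - ∑ E, α E * (edgeCount rel E A : ℝ)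

/-- `A` is strong in `B`: `A ⊆ B` and `δ(A) ≤ δ(A')` for all `A ⊆ A' ⊆ B`. -/
def strong {L V : Type} [Fintype L] (α : L → ℝ) (rel : L → Finset V → Prop)
    (A B : Finset V) : Prop :=
  A ⊆ B ∧ ∀ A' : Finset V, A ⊆ A' → A' ⊆ B → delta α rel A ≤ delta α rel A'

/-- Membership in `K_α`: all substructures have nonnegative rank. -/
def inK {L V : Type} [Fintype L] (α : L → ℝ) (rel : L → Finset V → Prop)
    (A : Finset V) : Prop :=
  ∀ A' ⊆ A, 0 ≤ delta α rel A'

/-- `(A, B)` is a minimal pair: `A ≤ C` for all `A ⊆ C ⊊ B` but `A ≰ B`. -/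
def minPair {L V : Type} [Fintype L] (α : L → ℝ) (rel : L → Finset V → Prop)
    (A B : Finset V) : Prop :=
  A ⊆ B ∧ (∀ C : Finset V, A ⊆ C → C ⊂ B → strong α rel A C) ∧ ¬ strong α rel A B

open FirstOrder FirstOrder.Language

/-- The language of hypergraphs for `L`: one `ar E`-ary relation symbol for each
`E ∈ L`, and no function symbols. -/
def hypLang (L : Type) (ar : L → ℕ) : Language :=
  { Functions := fun _ => Empty, Relations := fun n => {E : L // ar E = n} }

/-- The hyperedge relation induced on finite subsets by a `hypLang`-structure:
`E` holds on `e` iff some injective enumeration of `e` satisfies the symbol `E`. -/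
def relOf (L : Type) (ar : L → ℕ) (V : Type) [DecidableEq V]
    [(hypLang L ar).Structure V] : L → Finset V → Prop :=
  fun E e => ∃ x : Fin (ar E) → V, Function.Injective x ∧
    Finset.univ.image x = e ∧
    @Structure.RelMap (hypLang L ar) V _ (ar E) ⟨E, rfl⟩ x

/-- The relations are interpreted symmetrically and irreflexively. -/
def properStructure (L : Type) (ar : L → ℕ) (V : Type)
    [(hypLang L ar).Structure V] : Prop :=
  ∀ (n : ℕ) (R : (hypLang L ar).Relations n) (x : Fin n → V),
    (@Structure.RelMap (hypLang L ar) V _ n R x → Function.Injective x) ∧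
    ∀ σ : Equiv.Perm (Fin n),
      @Structure.RelMap (hypLang L ar) V _ n R x →
        @Structure.RelMap (hypLang L ar) V _ n R (x ∘ σ)

/-- `V ⊨ S_α`: `V` is a symmetric irreflexive structure, every finite
substructure lies in `K_α`, and for all `A ≤ B` in `K_α` every embedding of `A`
into `V` extends to an embedding of `B` into `V`. -/
def modelsSalpha (L : Type) [Fintype L] (ar : L → ℕ) (α : L → ℝ) (V : Type)
    [DecidableEq V] [(hypLang L ar).Structure V] : Prop :=
  properStructure L ar V ∧
  (∀ A : Finset V, inK α (relOf L ar V) A) ∧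
  ∀ rel' : L → Finset ℕ → Prop, (∀ E e, rel' E e → e.card = ar E) →
    ∀ A B : Finset ℕ, A ⊆ B → inK α rel' B → strong α rel' A B →
      ∀ f : ℕ → V, Set.InjOn f ↑A →
        (∀ E (e : Finset ℕ), e ⊆ A → (rel' E e ↔ relOf L ar V E (e.image f))) →
        ∃ g : ℕ → V, Set.InjOn g ↑B ∧ (∀ a ∈ A, g a = f a) ∧
          ∀ E (e : Finset ℕ), e ⊆ B → (rel' E e ↔ relOf L ar V E (e.image g))

/-- `V` is an atomic model: the type of every finite tuple is isolated by a
single formula, relative to the class of models of `S_α`. -/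
def atomicModel (L : Type) [Fintype L] (ar : L → ℕ) (α : L → ℝ) (V : Type)
    [DecidableEq V] [(hypLang L ar).Structure V] : Prop :=
  ∀ (n : ℕ) (a : Fin n → V), ∃ φ : (hypLang L ar).Formula (Fin n),
    φ.Realize a ∧
    ∀ ψ : (hypLang L ar).Formula (Fin n), ψ.Realize a →
      ∀ (W : Type) [DecidableEq W] [(hypLang L ar).Structure W],
        modelsSalpha L ar α W → ∀ b : Fin n → W, φ.Realize b → ψ.Realize b

/-! ### Calculus of the rank function -/

open Classical in
/-- The hyperedges contained in `A`, labelled by their relation symbol. -/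
noncomputable def edges {L V : Type} [Fintype L] (rel : L → Finset V → Prop) (A : Finset V) :
    Finset (L × Finset V) :=
  {p ∈ univ ×ˢ A.powerset | rel p.1 p.2}

/-- `g` restricts to an isomorphism from the structure `rel'` on `B` onto its image in `rel`. -/
def IsEmb {L T V : Type} [DecidableEq V] (rel' : L → Finset T → Prop) (rel : L → Finset V → Prop)
    (B : Finset T) (g : T → V) : Prop :=
  Set.InjOn g ↑B ∧ ∀ E, ∀ e ⊆ B, (rel' E e ↔ rel E (e.image g))

/-- `A` is strong in every subset of `B` having at most `m` points outside `A`. -/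
def mStrong {L V : Type} [Fintype L] [DecidableEq V] (α : L → ℝ) (rel : L → Finset V → Prop)
    (m : ℕ) (A B : Finset V) : Prop :=
  ∀ D, A ⊆ D → D ⊆ B → #(D \ A) ≤ m → delta α rel A ≤ delta α rel D

section Embeddings

variable {L V T : Type} [DecidableEq V] {rel : L → Finset V → Prop} {rel' : L → Finset T → Prop}

lemma IsEmb.mono {B B' : Finset T} {g : T → V} (hg : IsEmb rel' rel B g) (h : B' ⊆ B) :
    IsEmb rel' rel B' g :=
  ⟨hg.1.mono (by exact_mod_cast h), fun E e he => hg.2 E e (he.trans h)⟩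

lemma IsEmb.comp {S : Type} [DecidableEq T] {rel'' : L → Finset S → Prop} {C : Finset S}
    {B : Finset T} {g : T → V} {f : S → T}
    (hg : IsEmb rel' rel B g) (hf : IsEmb rel'' rel' C f) (h : C.image f ⊆ B) :
    IsEmb rel'' rel C (g ∘ f) := by
  refine ⟨hg.1.comp hf.1 fun a ha => ?_, fun E e he => ?_⟩
  · exact_mod_cast h (mem_image_of_mem f ha)
  · rw [hf.2 E e he, hg.2 E _ ((image_subset_image he).trans h), image_image]

end Embeddings

section Rank

variable {L V T : Type} [Fintype L] {α : L → ℝ} {rel : L → Finset V → Prop}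
  {rel' : L → Finset T → Prop} {ar : L → ℕ}

@[simp] lemma mem_edges {A : Finset V} {p : L × Finset V} :
    p ∈ edges rel A ↔ p.2 ⊆ A ∧ rel p.1 p.2 := by
  simp [edges]

lemma delta_eq (α : L → ℝ) (rel : L → Finset V → Prop) (A : Finset V) :
    delta α rel A = #A - ∑ p ∈ edges rel A, α p.1 := by
  classical
  unfold delta edges
  congr 1
  rw [Finset.sum_filter, Finset.sum_product]
  refine Finset.sum_congr rfl fun E _ => ?_
  rw [← Finset.sum_filter, Finset.sum_congr rfl (g := fun _ => α E) fun _ _ => rfl,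
    Finset.sum_const, nsmul_eq_mul, mul_comm]
  congr 2
  rw [edgeCount, ← Set.ncard_coe_finset]
  congr 1
  ext e
  simp

lemma edges_mono {A B : Finset V} (h : A ⊆ B) : edges rel A ⊆ edges rel B := by
  intro p hp
  rw [mem_edges] at hp ⊢
  exact ⟨hp.1.trans h, hp.2⟩

lemma delta_congr {rel₁ rel₂ : L → Finset V → Prop} {A : Finset V}
    (h : ∀ E, ∀ e ⊆ A, (rel₁ E e ↔ rel₂ E e)) : delta α rel₁ A = delta α rel₂ A := by
  rw [delta_eq, delta_eq]
  have : edges rel₁ A = edges rel₂ A := by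
    ext p
    simp only [mem_edges]
    exact and_congr_right fun hp => h _ _ hp
  rw [this]

lemma delta_empty (hr : ∀ E e, rel E e → #e = ar E) (har : ∀ E, 2 ≤ ar E) :
    delta α rel ∅ = 0 := by
  have : edges rel (∅ : Finset V) = ∅ := by
    ext p
    simp only [mem_edges, subset_empty, notMem_empty, iff_false, not_and]
    intro h h'
    have h1 := hr _ _ h'
    have h2 := har p.1
    rw [h, Finset.card_empty] at h1
    omega
  rw [delta_eq, this]
  simp

lemma delta_singleton (hr : ∀ E e, rel E e → #e = ar E) (har : ∀ E, 2 ≤ ar E) (x : V) :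
    delta α rel {x} = 1 := by
  have : edges rel ({x} : Finset V) = ∅ := by
    ext p
    simp only [mem_edges, notMem_empty, iff_false, not_and]
    intro h h'
    have h1 := hr _ _ h'
    have h2 := har p.1
    have h3 := card_le_card h
    rw [card_singleton] at h3
    omega
  rw [delta_eq, this]
  simp

variable [DecidableEq V]

lemma delta_union_add_inter_le (hα : ∀ E, 0 ≤ α E) (A B : Finset V) :
    delta α rel (A ∪ B) + delta α rel (A ∩ B) ≤ delta α rel A + delta α rel B := by
  classical
  simp only [delta_eq]
  have h1 : (#(A ∪ B) : ℝ) + #(A ∩ B) = #A + #B := by exact_mod_cast card_union_add_card_inter A B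
  have h2 := Finset.sum_union_inter (s₁ := edges rel A) (s₂ := edges rel B)
    (f := fun p => α p.1)
  have h3 : edges rel A ∩ edges rel B = edges rel (A ∩ B) := by
    ext p
    simp only [mem_inter, mem_edges, subset_inter_iff]
    tauto
  have h4 : ∑ p ∈ edges rel A ∪ edges rel B, α p.1 ≤ ∑ p ∈ edges rel (A ∪ B), α p.1 :=
    Finset.sum_le_sum_of_subset_of_nonneg
      (union_subset (edges_mono subset_union_left) (edges_mono subset_union_right))
      fun p _ _ => hα p.1
  rw [h3] at h2
  linarith

lemma delta_union_add_inter_eq {A B : Finset V}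
    (h : ∀ E e, rel E e → e ⊆ A ∪ B → e ⊆ A ∨ e ⊆ B) :
    delta α rel (A ∪ B) + delta α rel (A ∩ B) = delta α rel A + delta α rel B := by
  classical
  simp only [delta_eq]
  have h1 : (#(A ∪ B) : ℝ) + #(A ∩ B) = #A + #B := by exact_mod_cast card_union_add_card_inter A B
  have h2 := Finset.sum_union_inter (s₁ := edges rel A) (s₂ := edges rel B)
    (f := fun p => α p.1)
  have h3 : edges rel A ∩ edges rel B = edges rel (A ∩ B) := by
    ext p
    simp only [mem_inter, mem_edges, subset_inter_iff]
    tauto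
  have h4 : edges rel A ∪ edges rel B = edges rel (A ∪ B) := by
    apply subset_antisymm
    · exact union_subset (edges_mono subset_union_left) (edges_mono subset_union_right)
    · intro p hp
      simp only [mem_union, mem_edges] at hp ⊢
      rcases h _ _ hp.2 hp.1 with h | h
      · exact Or.inl ⟨h, hp.2⟩
      · exact Or.inr ⟨h, hp.2⟩
  rw [h3, h4] at h2
  linarith

lemma exists_image_eq {B : Finset T} {g : T → V} {D : Finset V} (h : D ⊆ B.image g) :
    ∃ D' ⊆ B, D'.image g = D := by
  classical
  exact Finset.subset_image_iff.1 h

lemma IsEmb.delta_image {B D : Finset T} {g : T → V} (hg : IsEmb rel' rel B g) (h : D ⊆ B) :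
    delta α rel (D.image g) = delta α rel' D := by
  classical
  rw [delta_eq, delta_eq, card_image_of_injOn (hg.1.mono (by exact_mod_cast h))]
  congr 1
  symm
  refine Finset.sum_bij (fun p _ => (p.1, p.2.image g)) ?_ ?_ ?_ ?_
  · intro p hp
    rw [mem_edges] at hp ⊢
    exact ⟨image_subset_image hp.1, (hg.2 _ _ (hp.1.trans h)).1 hp.2⟩
  · intro p hp q hq hpq
    rw [mem_edges] at hp hq
    rw [Prod.mk.injEq] at hpq
    refine Prod.ext hpq.1 ?_
    have := hpq.2
    rw [← coe_inj, coe_image, coe_image] at this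
    exact_mod_cast (hg.1.image_eq_image_iff (by exact_mod_cast hp.1.trans h)
      (by exact_mod_cast hq.1.trans h)).1 this
  · intro p hp
    rw [mem_edges] at hp
    obtain ⟨e, he, hep⟩ := exists_image_eq hp.1
    refine ⟨(p.1, e), ?_, ?_⟩
    · rw [mem_edges]
      refine ⟨he, (hg.2 _ _ (he.trans h)).2 ?_⟩
      rw [hep]
      exact hp.2
    · rw [hep]
  · intros
    rfl

lemma delta_image_le (hα : ∀ E, 0 ≤ α E) {B : Finset T} {g : T → V} (hg : Set.InjOn g ↑B)
    (h : ∀ E, ∀ e ⊆ B, rel' E e → rel E (e.image g)) :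
    delta α rel (B.image g) ≤ delta α rel' B := by
  classical
  rw [delta_eq, delta_eq, card_image_of_injOn hg]
  have hinj : Set.InjOn (fun p : L × Finset T => (p.1, p.2.image g)) ↑(edges rel' B) := by
    intro p hp q hq hpq
    rw [mem_coe, mem_edges] at hp hq
    simp only [Prod.mk.injEq] at hpq
    refine Prod.ext hpq.1 ?_
    have := hpq.2
    rw [← coe_inj, coe_image, coe_image] at this
    exact_mod_cast (hg.image_eq_image_iff (by exact_mod_cast hp.1)
      (by exact_mod_cast hq.1)).1 this
  have h1 : ∑ p ∈ (edges rel' B).image (fun p => (p.1, p.2.image g)), α p.1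
      = ∑ p ∈ edges rel' B, α p.1 := Finset.sum_image hinj
  have h2 : ∑ p ∈ (edges rel' B).image (fun p => (p.1, p.2.image g)), α p.1
      ≤ ∑ p ∈ edges rel (B.image g), α p.1 := by
    refine Finset.sum_le_sum_of_subset_of_nonneg ?_ fun p _ _ => hα p.1
    intro p hp
    obtain ⟨q, hq, rfl⟩ := mem_image.1 hp
    rw [mem_edges] at hq ⊢
    exact ⟨image_subset_image hq.1, h _ _ hq.1 hq.2⟩
  linarith

lemma strong.mStrong {A B : Finset V} (h : strong α rel A B) (m : ℕ) : mStrong α rel m A B :=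
  fun D h1 h2 _ => h.2 D h1 h2

lemma mStrong.mono {A B : Finset V} {m m' : ℕ} (h : mStrong α rel m' A B) (hm : m ≤ m') :
    mStrong α rel m A B :=
  fun D h1 h2 h3 => h D h1 h2 (h3.trans hm)

lemma mStrong.delta_inter_le (hα : ∀ E, 0 ≤ α E) {A B D : Finset V} {m : ℕ}
    (h : mStrong α rel m A B) (hA : A ⊆ B) (hD : D ⊆ B) (hm : #(D \ A) ≤ m) :
    delta α rel (D ∩ A) ≤ delta α rel D := by
  have h1 := delta_union_add_inter_le (rel := rel) hα D A
  have h2 := h (D ∪ A) subset_union_right (union_subset hD hA) (by rwa [union_sdiff_right])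
  linarith

lemma mStrong.trans (hα : ∀ E, 0 ≤ α E) {A B C : Finset V} {m : ℕ} (hAB : A ⊆ B) (hBC : B ⊆ C)
    (h : mStrong α rel m A B) (h' : mStrong α rel m B C) : mStrong α rel m A C := by
  intro D hAD hDC hm
  have h1 : #(D \ B) ≤ m := (card_le_card (sdiff_subset_sdiff subset_rfl hAB)).trans hm
  have h2 := h'.delta_inter_le hα hBC hDC h1
  have h3 := h (D ∩ B) (subset_inter hAD hAB) inter_subset_right
    ((card_le_card (sdiff_subset_sdiff inter_subset_left subset_rfl)).trans hm)
  linarith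

lemma strong.delta_inter_le (hα : ∀ E, 0 ≤ α E) {A B D : Finset V}
    (h : strong α rel A B) (hD : D ⊆ B) : delta α rel (D ∩ A) ≤ delta α rel D :=
  (h.mStrong _).delta_inter_le hα h.1 hD le_rfl

lemma strong.inK (hα : ∀ E, 0 ≤ α E) {A B : Finset V} (h : strong α rel A B)
    (hA : inK α rel A) : inK α rel B :=
  fun _ hD => (hA _ inter_subset_right).trans (h.delta_inter_le hα hD)

lemma IsEmb.mStrong_image [DecidableEq T] {A B : Finset T} {g : T → V} {m : ℕ}
    (hg : IsEmb rel' rel B g) (hA : A ⊆ B) (h : mStrong α rel' m A B) :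
    mStrong α rel m (A.image g) (B.image g) := by
  intro _ h1 h2 h3
  obtain ⟨D, hD, rfl⟩ := exists_image_eq h2
  have hAD : A ⊆ D := by
    intro a ha
    obtain ⟨d, hd, hda⟩ := mem_image.1 (h1 (mem_image_of_mem g ha))
    rwa [← hg.1 (hD hd) (hA ha) hda]
  rw [hg.delta_image hA, hg.delta_image hD]
  refine h D hAD hD ?_
  rw [card_sdiff_of_subset h1, card_image_of_injOn (hg.1.mono (by exact_mod_cast hD)),
    card_image_of_injOn (hg.1.mono (by exact_mod_cast hA))] at h3
  rwa [card_sdiff_of_subset hAD]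

lemma IsEmb.strong_of_image {A B : Finset T} {g : T → V}
    (hg : IsEmb rel' rel B g) (hA : A ⊆ B) (h : strong α rel (A.image g) (B.image g)) :
    strong α rel' A B := by
  refine ⟨hA, fun D h1 h2 => ?_⟩
  rw [← hg.delta_image hA, ← hg.delta_image h2]
  exact h.2 _ (image_subset_image h1) (image_subset_image h2)

lemma IsEmb.inK_of_image {B : Finset T} {g : T → V}
    (hg : IsEmb rel' rel B g) (h : inK α rel (B.image g)) : inK α rel' B := by
  intro D hD
  rw [← hg.delta_image hD]
  exact h _ (image_subset_image hD)

end Rank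

/-! ### Integer combinations of the weights -/

section Weights

variable {L : Type} [Fintype L] {α : L → ℝ}

lemma exists_pos_lower_bound (hα : ∀ E, 0 < α E) : ∃ a > 0, ∀ E, a ≤ α E := by
  rcases isEmpty_or_nonempty L with h | h
  · exact ⟨1, one_pos, fun E => h.elim E⟩
  · obtain ⟨E, hE⟩ := Finite.exists_min α
    exact ⟨α E, hα E, hE⟩

/-- The positive values of `∑ q_E α_E - p` with `q_E ∈ ℕ` and `p ≤ m` are bounded away
from `0`. -/
lemma exists_gap (hα : ∀ E, 0 < α E) (m : ℕ) :
    ∃ ε > 0, ∀ p ≤ m, ∀ q : L → ℕ, (p : ℝ) < ∑ E, α E * q E → ε ≤ ∑ E, α E * q E - p := by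
  classical
  obtain ⟨a, ha, hle⟩ := exists_pos_lower_bound hα
  obtain ⟨Q, hQ⟩ := exists_nat_gt ((m + 1) / a)
  rw [div_lt_iff₀ ha] at hQ
  let S : Finset ℝ := insert 1 (((Fintype.piFinset fun _ : L => range (Q + 1)) ×ˢ
    range (m + 1)).image fun x => ∑ E, α E * (x.1 E : ℝ) - x.2) |>.filter (0 < ·)
  have h1 : (1 : ℝ) ∈ S := by simp [S]
  refine ⟨S.min' ⟨1, h1⟩, ?_, fun p hp q hpq => ?_⟩
  · have := S.min'_mem ⟨1, h1⟩
    exact (mem_filter.1 this).2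
  · by_cases hq : ∀ E, q E ≤ Q
    · refine S.min'_le _ ?_
      simp only [S, mem_filter, mem_insert, mem_image, mem_product, Fintype.mem_piFinset,
        mem_range, Prod.exists]
      exact ⟨Or.inr ⟨q, p, ⟨fun E => Nat.lt_succ_of_le (hq E), Nat.lt_succ_of_le hp⟩, rfl⟩,
        sub_pos.2 hpq⟩
    · push Not at hq
      obtain ⟨E, hE⟩ := hq
      refine (S.min'_le 1 h1).trans ?_
      have h2 : α E * q E ≤ ∑ E, α E * (q E : ℝ) :=
        Finset.single_le_sum (f := fun E => α E * (q E : ℝ))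
          (fun E _ => mul_nonneg (hα E).le (Nat.cast_nonneg _)) (mem_univ E)
      have h3 : (Q : ℝ) * a ≤ α E * q E := by
        rw [mul_comm]
        exact mul_le_mul (hle E) (by exact_mod_cast hE.le) (Nat.cast_nonneg _) (hα E).le
      have h4 : (p : ℝ) ≤ m := by exact_mod_cast hp
      linarith

lemma exists_nat_small_of_irrational {x η : ℝ} (hx : 0 < x) (hirr : Irrational x) (hη : 0 < η) :
    ∃ M N : ℕ, 0 < M * x - N ∧ M * x - N < η := by
  obtain ⟨n, hn⟩ := exists_nat_gt (1 / η)
  have hn0 : 0 < n := by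
    have : (0 : ℝ) < n := (one_div_pos.2 hη).trans hn
    exact_mod_cast this
  obtain ⟨k, hk0, -, hk⟩ := Real.exists_nat_abs_mul_sub_round_le x hn0
  have hlt : |(k : ℝ) * x - round (k * x)| < η := by
    refine hk.trans_lt ?_
    rw [div_lt_iff₀ (by positivity)]
    rw [div_lt_iff₀ hη] at hn
    nlinarith
  have hr0 : 0 ≤ round ((k : ℝ) * x) := by
    rw [round_eq]
    exact Int.floor_nonneg.2 (by positivity)
  obtain ⟨r, hr⟩ := Int.eq_ofNat_of_zero_le hr0
  rw [hr] at hlt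
  simp only [Int.cast_natCast] at hlt
  have hne : (k : ℝ) * x - r ≠ 0 := by
    intro h
    exact ((hirr.natCast_mul hk0.ne').ne_nat r) (by linarith)
  rcases lt_or_gt_of_ne hne with h | h
  · rw [abs_of_neg h] at hlt
    set e := -((k : ℝ) * x - r) with he
    have he0 : 0 < e := by linarith
    obtain ⟨j, hj1, hj2⟩ : ∃ j : ℕ, 0 ≤ x - j * e ∧ x - j * e < e := by
      refine ⟨⌊x / e⌋₊, ?_, ?_⟩
      · have := Nat.floor_le (div_nonneg hx.le he0.le)
        rw [le_div_iff₀ he0] at this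
        linarith
      · have := Nat.lt_floor_add_one (x / e)
        rw [div_lt_iff₀ he0] at this
        linarith
    refine ⟨1 + j * k, j * r, ?_, ?_⟩
    · have hne : ((1 + j * k : ℕ) : ℝ) * x - (j * r : ℕ) ≠ 0 := by
        intro h
        exact ((hirr.natCast_mul (by omega : 1 + j * k ≠ 0)).ne_nat (j * r)) (by linarith)
      refine lt_of_le_of_ne ?_ hne.symm
      push_cast
      nlinarith
    · push_cast
      nlinarith
  · rw [abs_of_pos h] at hlt
    exact ⟨k, r, h, hlt⟩

/-- There are combinations `t = ∑ M_E α_E - N > 0`, with `N` as large as desired, such that the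
group generated by `1` and the weights has no element in `[η, t)`. -/
lemma exists_step [Nonempty L] (hα : ∀ E, 0 < α E) (K : ℕ) {η : ℝ} (hη : 0 < η) :
    ∃ (M : L → ℕ) (N : ℕ), K ≤ N ∧ 0 < ∑ E, α E * M E - N ∧
      ∀ (p : ℤ) (q : L → ℤ), 0 < ∑ E, α E * q E - p →
        ∑ E, α E * q E - p < ∑ E, α E * M E - N → ∑ E, α E * q E - p < η := by
  classical
  by_cases hrat : ∃ E, Irrational (α E)
  · obtain ⟨E, hE⟩ := hrat
    obtain ⟨ε, hε, hgap⟩ := exists_gap hα K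
    obtain ⟨M, N, h1, h2⟩ := exists_nat_small_of_irrational (hα E) hE (lt_min hη hε)
    have hsum : ∑ E', α E' * ((Pi.single E M : L → ℕ) E' : ℝ) = M * α E := by
      rw [Finset.sum_eq_single E]
      · simp [mul_comm]
      · intro b _ hb
        simp [hb]
      · simp
    refine ⟨Pi.single E M, N, ?_, ?_, ?_⟩
    · by_contra hN
      have := hgap N (by omega) (Pi.single E M) (by rw [hsum]; linarith)
      rw [hsum] at this
      exact absurd (h2.trans_le (min_le_right _ _)) (not_lt.2 this)
    · rwa [hsum]
    · intro p q _ h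
      rw [hsum] at h
      exact (h.trans h2).trans_le (min_le_left _ _)
  · push Not at hrat
    simp only [Irrational, not_not, Set.mem_range] at hrat
    choose x hx using hrat
    set D : ℕ := ∏ E, (x E).den with hD
    have hD0 : 0 < D := Finset.prod_pos fun E _ => (x E).pos
    have hD0' : (0 : ℝ) < D := by exact_mod_cast hD0
    have h_nat : ∀ E, ∃ k : ℕ, 0 < k ∧ D * α E = k := by
      intro E
      obtain ⟨c, hc⟩ := Finset.dvd_prod_of_mem (fun E => (x E).den) (mem_univ E)
      have h1 : (D : ℝ) * α E = (((c : ℤ) * (x E).num : ℤ) : ℝ) := by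
        rw [← hx E]
        have h2 : ((x E : ℚ) : ℝ) * (x E).den = (x E).num := by exact_mod_cast Rat.mul_den_eq_num _
        rw [hD, hc]
        push_cast
        linear_combination (c : ℝ) * h2
      have h3 : 0 < (c : ℤ) * (x E).num := by
        have : (0 : ℝ) < (((c : ℤ) * (x E).num : ℤ) : ℝ) := by
          rw [← h1]
          exact mul_pos hD0' (hα E)
        exact_mod_cast this
      obtain ⟨k, hk⟩ := Int.eq_ofNat_of_zero_le h3.le
      refine ⟨k, by omega, ?_⟩
      rw [h1, hk]
      simp
    choose k hk0 hk using h_nat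
    have hval : ∀ (p : ℤ) (q : L → ℤ),
        D * (∑ E, α E * q E - p) = ((∑ E, k E * q E - D * p : ℤ) : ℝ) := by
      intro p q
      push_cast
      rw [mul_sub, Finset.mul_sum]
      congr 1
      refine Finset.sum_congr rfl fun E _ => ?_
      rw [← hk E]
      ring
    have hex : ∃ d : ℕ, 0 < d ∧ ∃ (p : ℤ) (q : L → ℤ), D * (∑ E, α E * q E - p) = d :=
      ⟨D, hD0, -1, 0, by simp⟩
    obtain ⟨hd0, p, q, hpq⟩ := Nat.find_spec hex
    set d := Nat.find hex with hd
    obtain ⟨T, hT1, hT2⟩ : ∃ T : ℕ, (K : ℤ) + |p| ≤ T ∧ ∀ E, |q E| ≤ T := by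
      refine ⟨K + p.natAbs + ∑ E, (q E).natAbs, ?_, fun E => ?_⟩
      · push_cast
        have : 0 ≤ ∑ E, |q E| := Finset.sum_nonneg fun E _ => abs_nonneg _
        linarith
      · push_cast
        have : |q E| ≤ ∑ E, |q E| :=
          Finset.single_le_sum (f := fun E => |q E|) (fun E _ => abs_nonneg _) (mem_univ E)
        have := abs_nonneg p
        have : (0 : ℤ) ≤ K := Int.natCast_nonneg _
        linarith
    have hM : ∀ E, ∃ M : ℕ, (M : ℤ) = q E + T * D := by
      intro E
      refine ⟨(q E + T * D).toNat, Int.toNat_of_nonneg ?_⟩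
      have h1 := hT2 E
      have h2 := neg_abs_le (q E)
      have h3 : (1 : ℤ) ≤ D := by exact_mod_cast hD0
      nlinarith [Int.natCast_nonneg T]
    choose M hM using hM
    have hS : (1 : ℤ) ≤ ∑ E, (k E : ℤ) := by
      obtain ⟨E⟩ := ‹Nonempty L›
      have h1 : (k E : ℤ) ≤ ∑ E, (k E : ℤ) :=
        Finset.single_le_sum (f := fun E => (k E : ℤ)) (fun E _ => Int.natCast_nonneg _)
          (mem_univ E)
      have := hk0 E
      omega
    have hN0 : (K : ℤ) ≤ p + T * ∑ E, (k E : ℤ) := by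
      have h2 := neg_abs_le p
      nlinarith [Int.natCast_nonneg T]
    obtain ⟨N, hN⟩ := Int.eq_ofNat_of_zero_le ((Int.natCast_nonneg K).trans hN0)
    have ht : ∑ E, α E * M E - N = ∑ E, α E * q E - p := by
      have h1 : ∀ E, (M E : ℝ) = q E + T * D := fun E => by exact_mod_cast hM E
      have h2 : (p : ℝ) + T * ∑ E, (k E : ℝ) = N := by exact_mod_cast hN
      rw [← h2, Finset.mul_sum]
      have h3 : ∑ E, α E * (M E : ℝ) = ∑ E, α E * (q E : ℝ) + ∑ E, (T : ℝ) * k E := by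
        rw [← Finset.sum_add_distrib]
        refine Finset.sum_congr rfl fun E _ => ?_
        rw [h1, ← hk E]
        ring
      rw [h3]
      ring
    refine ⟨M, N, by omega, ?_, ?_⟩
    · rw [ht]
      have : (0 : ℝ) < D * (∑ E, α E * q E - p) := by
        rw [hpq]
        exact_mod_cast hd0
      exact (mul_pos_iff_of_pos_left hD0').1 this
    · intro p' q' h0 hlt
      exfalso
      rw [ht] at hlt
      have h1 := hval p' q'
      have h2 : (0 : ℤ) < ∑ E, k E * q' E - D * p' := by
        have : (0 : ℝ) < ((∑ E, k E * q' E - D * p' : ℤ) : ℝ) := by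
          rw [← h1]
          exact mul_pos hD0' h0
        exact_mod_cast this
      obtain ⟨d', hd'⟩ := Int.eq_ofNat_of_zero_le h2.le
      rw [hd'] at h1
      have h3 : d ≤ d' := Nat.find_min' hex ⟨by omega, p', q', by rw [h1]; simp⟩
      have h4 : (D : ℝ) * (∑ E, α E * q' E - p') < D * (∑ E, α E * q E - p) :=
        mul_lt_mul_of_pos_left hlt hD0'
      rw [h1, hpq] at h4
      have : d' < d := by exact_mod_cast h4
      omega

/-- A sequence in which each `E` occurs `M E` times. -/
lemma exists_sequence [Nonempty L] (M : L → ℕ) :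
    ∃ (J : ℕ) (σ : ℕ → L), ∀ f : L → ℝ, ∑ j ∈ range J, f (σ j) = ∑ E, f E * M E := by
  classical
  let e := (Fintype.equivFin (Σ E, Fin (M E))).symm
  set J := Fintype.card (Σ E, Fin (M E))
  refine ⟨J, fun j => if h : j < J then (e ⟨j, h⟩).1 else Classical.arbitrary L, fun f => ?_⟩
  rw [← Fin.sum_univ_eq_sum_range (fun j => f (if h : j < J then (e ⟨j, h⟩).1
    else Classical.arbitrary L))]
  simp only [Fin.is_lt, dite_true, Fin.eta]
  rw [Equiv.sum_comp e (fun x => f x.1), Fintype.sum_sigma]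
  simp [mul_comm]

lemma exists_partial_sum_eq (σ : ℕ → L) (j : ℕ) :
    ∃ q : L → ℕ, ∑ i ∈ range j, α (σ i) = ∑ E, α E * q E := by
  classical
  refine ⟨fun E => #{i ∈ range j | σ i = E}, ?_⟩
  rw [← Finset.sum_fiberwise (range j) σ]
  refine Finset.sum_congr rfl fun E _ => ?_
  rw [Finset.sum_congr rfl (g := fun _ => α E) fun i hi => by rw [(mem_filter.1 hi).2],
    Finset.sum_const, nsmul_eq_mul, mul_comm]

end Weights

/-! ### Sparse structures of small rank

The vertices are the cells `[i, i + 1)` of an interval which is covered by consecutive segments,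
one segment of length `α E` for each `E`-hyperedge. A hyperedge contains the cells met by its
segment, so that the length of the segment is distributed among the vertices of the hyperedge. -/

section Window

/-- The vertex `a` steps after `i` in the cyclic order of `{0, …, n - 1}`. -/
def cyclicShift (n i a : ℕ) : ℕ := if i + a < n then i + a else i + a - n

/-- The set consisting of `i` and of `r - 1` cyclically consecutive vertices, the first one
being `k + 1` steps after `i`. -/
def cyclicWindow (n r i k : ℕ) : Finset ℕ :=
  insert i ((range (r - 1)).image fun c => cyclicShift n i (k + 1 + c))

variable {n r i k Q : ℕ}

lemma mem_cyclicWindow {x : ℕ} :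
    x ∈ cyclicWindow n r i k ↔ x = i ∨ ∃ c < r - 1, cyclicShift n i (k + 1 + c) = x := by
  simp [cyclicWindow]

lemma cyclicWindow_subset (hn : Q + r + 2 ≤ n) (hi : i < n) (hk : k ≤ Q) :
    cyclicWindow n r i k ⊆ range n := by
  intro x hx
  rw [mem_cyclicWindow] at hx
  rw [mem_range]
  rcases hx with rfl | ⟨c, hc, rfl⟩
  · exact hi
  · unfold cyclicShift
    split_ifs <;> omega

lemma card_cyclicWindow (hr : 2 ≤ r) (hn : Q + r + 2 ≤ n) (hk : k ≤ Q) :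
    #(cyclicWindow n r i k) = r := by
  rw [cyclicWindow, card_insert_of_notMem, card_image_of_injOn, card_range]
  · omega
  · intro c hc c' hc' h
    simp only [coe_range, Set.mem_Iio] at hc hc'
    simp only [cyclicShift] at h
    split_ifs at h <;> omega
  · simp only [mem_image, mem_range, not_exists, not_and]
    intro c hc
    unfold cyclicShift
    split_ifs <;> omega

lemma succ_mem_cyclicWindow (hr : 2 ≤ r) (hi : i + 1 < n) : i + 1 ∈ cyclicWindow n r i 0 := by
  rw [mem_cyclicWindow]
  refine Or.inr ⟨0, by omega, ?_⟩
  simp [cyclicShift, hi]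

lemma cyclicWindow_injective {i' k' : ℕ} (hr : 2 ≤ r) (hn : 2 * (Q + r + 2) ≤ n) (hi : i < n)
    (hi' : i' < n) (hk : k ≤ Q) (hk' : k' ≤ Q)
    (h : cyclicWindow n r i k = cyclicWindow n r i' k') : i = i' ∧ k = k' := by
  have h1 : i ∈ cyclicWindow n r i' k' := h ▸ mem_insert_self _ _
  have h2 : i' ∈ cyclicWindow n r i k := h ▸ mem_insert_self _ _
  rw [mem_cyclicWindow] at h1 h2
  have hii : i = i' := by
    rcases h1 with h1 | ⟨c, hc, h1⟩
    · exact h1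
    · rcases h2 with h2 | ⟨c', hc', h2⟩
      · exact h2.symm
      · simp only [cyclicShift] at h1 h2
        split_ifs at h1 h2 <;> omega
  subst hii
  refine ⟨rfl, ?_⟩
  have h3 : cyclicShift n i (k + 1 + 0) ∈ cyclicWindow n r i k' :=
    h ▸ mem_cyclicWindow.2 (Or.inr ⟨0, by omega, rfl⟩)
  have h4 : cyclicShift n i (k' + 1 + 0) ∈ cyclicWindow n r i k :=
    h ▸ mem_cyclicWindow.2 (Or.inr ⟨0, by omega, rfl⟩)
  rw [mem_cyclicWindow] at h3 h4
  have h5 : k' ≤ k := by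
    rcases h3 with h3 | ⟨c, hc, h3⟩ <;> simp only [cyclicShift] at h3 <;>
      split_ifs at h3 <;> omega
  have h6 : k ≤ k' := by
    rcases h4 with h4 | ⟨c, hc, h4⟩ <;> simp only [cyclicShift] at h4 <;>
      split_ifs at h4 <;> omega
  omega

end Window

section Overlap

/-- The length of the intersection of `[u j, u (j + 1)]` and `[i, i + 1]`. -/
noncomputable def overlap (u : ℕ → ℝ) (j i : ℕ) : ℝ :=
  (min (u (j + 1)) ((i + 1 : ℕ) : ℝ) - min (u (j + 1)) (i : ℝ)) -
    (min (u j) ((i + 1 : ℕ) : ℝ) - min (u j) (i : ℝ))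

variable {u : ℕ → ℝ}

lemma overlap_nonneg (hu : Monotone u) (j i : ℕ) : 0 ≤ overlap u j i := by
  have h := hu (Nat.le_succ j)
  simp only [Nat.succ_eq_add_one] at h
  unfold overlap
  push_cast
  simp only [min_def]
  split_ifs <;> linarith

lemma sum_overlap_cells {n j : ℕ} (h0 : 0 ≤ u j) (h1 : u j ≤ u (j + 1)) (hn : u (j + 1) ≤ n) :
    ∑ i ∈ range n, overlap u j i = u (j + 1) - u j := by
  unfold overlap
  rw [Finset.sum_sub_distrib, Finset.sum_range_sub (fun i => min (u (j + 1)) (i : ℝ)),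
    Finset.sum_range_sub (fun i => min (u j) (i : ℝ))]
  rw [min_eq_left hn, min_eq_left (h1.trans hn)]
  simp [h0, h0.trans h1]

lemma sum_overlap_segments {n J i : ℕ} (h0 : 0 ≤ u 0) (h1 : u 0 < 1) (hJ : u J = n) (hi : i < n) :
    ∑ j ∈ range J, overlap u j i = 1 - if i = 0 then u 0 else 0 := by
  unfold overlap
  rw [Finset.sum_range_sub (fun j => min (u j) ((i + 1 : ℕ) : ℝ) - min (u j) (i : ℝ)), hJ]
  have h2 : ((i + 1 : ℕ) : ℝ) ≤ n := by exact_mod_cast hi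
  have h3 : (i : ℝ) ≤ n := by exact_mod_cast hi.le
  rw [min_eq_right h2, min_eq_right h3]
  split_ifs with h
  · subst h
    simp [h0, h1.le]
  · have h4 : (1 : ℝ) ≤ i := by exact_mod_cast Nat.one_le_iff_ne_zero.2 h
    rw [min_eq_left (by push_cast; linarith), min_eq_left (by linarith)]
    push_cast
    ring

lemma overlap_eq_zero {j i : ℕ} (h0 : 0 ≤ u j) (h1 : u j ≤ u (j + 1)) (h2 : u (j + 1) ≤ u j + 1)
    (hi : i ≠ ⌊u j⌋₊) (hi' : i = ⌊u j⌋₊ + 1 → u (j + 1) < (⌊u j⌋₊ + 1 : ℕ)) :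
    overlap u j i = 0 := by
  have h3 := Nat.floor_le h0
  have h4 := Nat.lt_floor_add_one (u j)
  unfold overlap
  rcases lt_or_gt_of_ne hi with h | h
  · have h5 : ((i + 1 : ℕ) : ℝ) ≤ ⌊u j⌋₊ := by exact_mod_cast h
    have h6 : (i : ℝ) ≤ (i + 1 : ℕ) := by exact_mod_cast Nat.le_succ i
    rw [min_eq_right (by linarith), min_eq_right (by linarith), min_eq_right (by linarith),
      min_eq_right (by linarith)]
    ring
  · have h6 : (i : ℝ) ≤ (i + 1 : ℕ) := by exact_mod_cast Nat.le_succ i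
    have h5 : u (j + 1) ≤ i := by
      rcases Nat.lt_or_ge (⌊u j⌋₊ + 1) i with h7 | h7
      · have : ((⌊u j⌋₊ + 1 + 1 : ℕ) : ℝ) ≤ i := by exact_mod_cast h7
        push_cast at this
        linarith
      · have h8 : i = ⌊u j⌋₊ + 1 := by omega
        rw [h8]
        exact (hi' h8).le
    rw [min_eq_left (by linarith), min_eq_left (by linarith), min_eq_left (by linarith),
      min_eq_left (by linarith)]
    ring

end Overlap

section Gadget

variable {u : ℕ → ℝ} {n J : ℕ} {e : ℕ → Finset ℕ} {H : Finset ℕ}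

lemma sum_sum_overlap (h0 : 0 ≤ u 0) (h1 : u 0 < 1) (hJ : u J = n) (hH : H ⊆ range n) :
    ∑ j ∈ range J, ∑ i ∈ H, overlap u j i = #H - if 0 ∈ H then u 0 else 0 := by
  rw [Finset.sum_comm, Finset.sum_congr rfl fun i hi =>
    sum_overlap_segments h0 h1 hJ (mem_range.1 (hH hi)), Finset.sum_sub_distrib,
    Finset.sum_ite_eq']
  simp

lemma sum_covered_segments (hu : Monotone u) (h0 : 0 ≤ u 0) (hJ : u J = n) (hH : H ⊆ range n)
    (he : ∀ j < J, ∀ i < n, i ∉ e j → overlap u j i = 0) :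
    ∑ j ∈ range J with e j ⊆ H, (u (j + 1) - u j) =
      ∑ j ∈ range J with e j ⊆ H, ∑ i ∈ H, overlap u j i := by
  refine Finset.sum_congr rfl fun j hj => ?_
  rw [mem_filter, mem_range] at hj
  rw [← sum_overlap_cells (n := n) (h0.trans (hu (Nat.zero_le j))) (hu (Nat.le_succ j))
    (hJ ▸ hu hj.1)]
  refine (Finset.sum_subset hH fun i hi hiH => ?_).symm
  exact he j hj.1 i (mem_range.1 hi) fun h => hiH (hj.2 h)

lemma sum_covered_segments_le (hu : Monotone u) (h0 : 0 ≤ u 0) (h1 : u 0 < 1) (hJ : u J = n)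
    (hH : H ⊆ range n) (he : ∀ j < J, ∀ i < n, i ∉ e j → overlap u j i = 0) :
    ∑ j ∈ range J with e j ⊆ H, (u (j + 1) - u j) ≤ #H - if 0 ∈ H then u 0 else 0 := by
  rw [sum_covered_segments hu h0 hJ hH he, ← sum_sum_overlap h0 h1 hJ hH]
  exact Finset.sum_le_sum_of_subset_of_nonneg (filter_subset _ _) fun j _ _ =>
    Finset.sum_nonneg fun i _ => overlap_nonneg hu j i

lemma sum_covered_segments_add_le (hu : Monotone u) (h0 : 0 ≤ u 0) (h1 : u 0 < 1) (hJ : u J = n)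
    (hH : H ⊆ range n) (he : ∀ j < J, ∀ i < n, i ∉ e j → overlap u j i = 0) {j i : ℕ}
    (hj : j < J) (hjH : ¬ e j ⊆ H) (hi : i ∈ H) :
    ∑ j ∈ range J with e j ⊆ H, (u (j + 1) - u j) + overlap u j i ≤
      #H - if 0 ∈ H then u 0 else 0 := by
  rw [sum_covered_segments hu h0 hJ hH he, ← sum_sum_overlap h0 h1 hJ hH,
    ← Finset.sum_filter_add_sum_filter_not (range J) (fun j => e j ⊆ H)]
  gcongr
  refine (Finset.single_le_sum (f := fun i => overlap u j i)
    (fun i _ => overlap_nonneg hu j i) hi).trans ?_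
  exact Finset.single_le_sum (f := fun j => ∑ i ∈ H, overlap u j i)
    (fun j _ => Finset.sum_nonneg fun i _ => overlap_nonneg hu j i)
    (mem_filter.2 ⟨mem_range.2 hj, hjH⟩)

/-- The rank of a structure whose hyperedges are enumerated without repetition. -/
lemma delta_of_enumeration {L V : Type} [Fintype L] [DecidableEq V] {α : L → ℝ} {σ : ℕ → L}
    {e : ℕ → Finset V}
    (hinj : ∀ j < J, ∀ j' < J, σ j = σ j' → e j = e j' → j = j') (H : Finset V) :
    delta α (fun E f => ∃ j < J, σ j = E ∧ f = e j) H =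
      #H - ∑ j ∈ range J with e j ⊆ H, α (σ j) := by
  classical
  rw [delta_eq]
  congr 1
  have h1 : edges (fun E f => ∃ j < J, σ j = E ∧ f = e j) H =
      {j ∈ range J | e j ⊆ H}.image fun j => (σ j, e j) := by
    ext ⟨E, f⟩
    simp only [mem_edges, mem_image, mem_filter, mem_range, Prod.mk.injEq]
    constructor
    · rintro ⟨h, j, hj, rfl, rfl⟩
      exact ⟨j, ⟨hj, h⟩, rfl, rfl⟩
    · rintro ⟨j, ⟨hj, h⟩, rfl, rfl⟩
      exact ⟨h, j, hj, rfl, rfl⟩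
  rw [h1, Finset.sum_image]
  intro j hj j' hj' h
  simp only [coe_filter, Set.mem_ofPred_eq, mem_range] at hj hj'
  rw [Prod.mk.injEq] at h
  exact hinj j hj.1 j' hj'.1 h.1 h.2

/-- The hyperedges of the gadget are pairwise distinct. -/
lemma segment_injective {Q : ℕ} {r : ℕ} (hu : Monotone u) (h0 : 0 ≤ u 0) (hJ : u J = n)
    (hlt : ∀ j, u j < u (j + 1)) (hQ : ∀ j, u j + 1 ≤ u (j + Q)) (hQ0 : 0 < Q)
    (hr : 2 ≤ r) (hn : 2 * (Q + r + 2) ≤ n) {k : ℕ → ℕ}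
    (hk : ∀ j, k j = if ((⌊u j⌋₊ + 1 : ℕ) : ℝ) ≤ u (j + 1) then 0 else j % Q + 1)
    {j j' : ℕ} (hj : j < J) (hj' : j' < J)
    (h : cyclicWindow n r ⌊u j⌋₊ (k j) = cyclicWindow n r ⌊u j'⌋₊ (k j')) : j = j' := by
  have hnn : ∀ j, 0 ≤ u j := fun j => h0.trans (hu (Nat.zero_le j))
  have hcell : ∀ j < J, ⌊u j⌋₊ < n := fun j hj => by
    rw [Nat.floor_lt (hnn j), ← hJ]
    exact (hlt j).trans_le (hu hj)
  have hkQ : ∀ j, k j ≤ Q := fun j => by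
    rw [hk]
    split_ifs
    · omega
    · exact Nat.mod_lt j hQ0
  obtain ⟨h1, h2⟩ := cyclicWindow_injective hr hn (hcell j hj) (hcell j' hj') (hkQ j) (hkQ j') h
  clear hj hj' h
  wlog hjj : j < j' generalizing j j'
  · rcases (not_lt.1 hjj).eq_or_lt with h | h
    · exact h.symm
    · exact (this h1.symm h2.symm h).symm
  exfalso
  have h3 := hu (Nat.succ_le_of_lt hjj)
  have h4 := Nat.lt_floor_add_one (u j')
  have h5 := Nat.floor_le (hnn j)
  rw [← h1] at h4
  rw [hk j, hk j', ← h1] at h2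
  split_ifs at h2 with h6 h7
  · push_cast at h6
    linarith
  · have h8 : j + Q ≤ j' := by
      have h9 : j ≡ j' [MOD Q] := Nat.succ_injective h2
      have := Nat.le_of_dvd (by omega) ((Nat.modEq_iff_dvd' hjj.le).1 h9)
      omega
    have h10 := hu h8
    have h11 := hQ j
    linarith

/-- For every `m` and `η > 0` there are `t > 0` and a finite structure on `{0, …, n - 1}` of rank
at most `1 - t` such that substructures not containing `0` have nonnegative rank, substructures
containing `0` have rank at least `1 - t`, and at least `1` if they are small; moreover no
rank difference lies in `[η, t)`. -/
lemma exists_gadget {L : Type} [Fintype L] [Nonempty L] {ar : L → ℕ} (har : ∀ E, 2 ≤ ar E)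
    {α : L → ℝ} (hα : ∀ E, 0 < α E ∧ α E ≤ 1) (m : ℕ) {η : ℝ} (hη : 0 < η) :
    ∃ (t : ℝ) (n : ℕ) (rel : L → Finset ℕ → Prop), 0 < t ∧
      (∀ (p : ℤ) (q : L → ℤ), 0 < ∑ E, α E * q E - p → ∑ E, α E * q E - p < t →
        ∑ E, α E * q E - p < η) ∧ 0 < n ∧ (∀ E e, rel E e → #e = ar E) ∧
      (∀ H ⊆ range n, (0 ∉ H → 0 ≤ delta α rel H) ∧ (0 ∈ H → 1 - t ≤ delta α rel H) ∧
        (0 ∈ H → #H ≤ m + 1 → 1 ≤ delta α rel H)) ∧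
      delta α rel (range n) ≤ 1 - t := by
  classical
  obtain ⟨ε, hε, hgap⟩ := exists_gap (fun E => (hα E).1) m
  obtain ⟨a, ha, hle⟩ := exists_pos_lower_bound fun E => (hα E).1
  obtain ⟨Q, hQ⟩ := exists_nat_gt (1 / a)
  have hQ0 : 0 < Q := by
    have : (0 : ℝ) < Q := (one_div_pos.2 ha).trans hQ
    exact_mod_cast this
  rw [div_lt_iff₀ ha] at hQ
  obtain ⟨M, N, hKN, ht, hstep⟩ := exists_step (fun E => (hα E).1)
    (m + 1 + 2 * (Q + ∑ E, ar E + 2)) (lt_min hη (lt_min one_pos hε))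
  obtain ⟨J, σ, hσ⟩ := exists_sequence M
  set t := ∑ E, α E * M E - N with ht_def
  have ht1 : t ≤ 1 := by
    by_contra! h
    have := hstep (-1) 0 (by simp) (by simpa using h)
    simp at this
  set u : ℕ → ℝ := fun j => ∑ i ∈ range j, α (σ i) + (1 - t) with hu_def
  have hus : ∀ j, u (j + 1) = u j + α (σ j) := fun j => by
    simp only [hu_def, Finset.sum_range_succ]
    ring
  have hlt : ∀ j, u j < u (j + 1) := fun j => by
    rw [hus]
    linarith [(hα (σ j)).1]
  have hu : Monotone u := monotone_nat_of_le_succ fun j => (hlt j).le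
  have h0 : 0 ≤ u 0 := by simpa [hu_def] using ht1
  have h1 : u 0 < 1 := by simpa [hu_def] using ht
  have h0t : u 0 = 1 - t := by simp [hu_def]
  have hJ : u J = (N + 1 : ℕ) := by
    simp only [hu_def, hσ α, ht_def]
    push_cast
    ring
  have hnn : ∀ j, 0 ≤ u j := fun j => h0.trans (hu (Nat.zero_le j))
  have hcell : ∀ j < J, ⌊u j⌋₊ < N + 1 := fun j hj => by
    rw [Nat.floor_lt (hnn j), ← hJ]
    exact (hlt j).trans_le (hu hj)
  have hQu : ∀ j, u j + 1 ≤ u (j + Q) := fun j => by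
    have : ∀ i : ℕ, u j + i * a ≤ u (j + i) := fun i => by
      induction i with
      | zero => simp
      | succ i ih =>
        rw [← add_assoc, hus]
        push_cast
        linarith [hle (σ (j + i))]
    linarith [this Q]
  set k : ℕ → ℕ := fun j => if ((⌊u j⌋₊ + 1 : ℕ) : ℝ) ≤ u (j + 1) then 0 else j % Q + 1 with hk
  have hkQ : ∀ j, k j ≤ Q := fun j => by
    simp only [hk]
    split_ifs
    · omega
    · exact Nat.mod_lt j hQ0
  have hn : ∀ E, 2 * (Q + ar E + 2) ≤ N + 1 := fun E => by
    have := Finset.single_le_sum (f := ar) (fun _ _ => Nat.zero_le _) (mem_univ E)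
    omega
  have hn' : ∀ E, Q + ar E + 2 ≤ N + 1 := fun E => by linarith [hn E]
  set e : ℕ → Finset ℕ := fun j => cyclicWindow (N + 1) (ar (σ j)) ⌊u j⌋₊ (k j) with he
  have hov : ∀ j < J, ∀ i < N + 1, i ∉ e j → overlap u j i = 0 := by
    intro j hj i hi hie
    refine overlap_eq_zero (hnn j) (hlt j).le (by rw [hus]; linarith [(hα (σ j)).2]) ?_ ?_
    · rintro rfl
      exact hie (mem_insert_self _ _)
    · rintro rfl
      by_contra! h
      refine hie ?_
      have : k j = 0 := if_pos h
      simp only [he, this]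
      exact succ_mem_cyclicWindow (har _) hi
  have hinj : ∀ j < J, ∀ j' < J, σ j = σ j' → e j = e j' → j = j' := by
    intro j hj j' hj' h h'
    simp only [he, ← h] at h'
    exact segment_injective hu h0 hJ hlt hQu hQ0 (har _) (hn (σ j)) (fun _ => rfl) hj hj' h'
  have hδ := delta_of_enumeration (α := α) hinj
  have hseg : ∀ j, u (j + 1) - u j = α (σ j) := fun j => by rw [hus]; ring
  refine ⟨t, N + 1, fun E f => ∃ j < J, σ j = E ∧ f = e j, ht, ?_, Nat.succ_pos N, ?_, ?_, ?_⟩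
  · intro p q h h'
    exact (hstep p q h h').trans_le (min_le_left _ _)
  · rintro E _ ⟨j, hj, rfl, rfl⟩
    exact card_cyclicWindow (har _) (hn' _) (hkQ j)
  · intro H hH
    have h2 := sum_covered_segments_le hu h0 h1 hJ hH hov
    simp only [hseg] at h2
    rw [hδ]
    refine ⟨fun h => ?_, fun h => ?_, fun h hm => ?_⟩
    · rw [if_neg h] at h2
      linarith
    · rw [if_pos h] at h2
      linarith
    · have hex : ∃ i, i ∉ H := Infinite.exists_notMem_finset H
      obtain ⟨l, hl⟩ : ∃ l, Nat.find hex = l + 1 := by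
        refine Nat.exists_eq_succ_of_ne_zero fun h3 => ?_
        exact Nat.find_spec hex (h3 ▸ h)
      have hlH : ∀ i ≤ l, i ∈ H := fun i hi => by
        by_contra h3
        have := Nat.find_min' hex h3
        omega
      have hlH' : l + 1 ∉ H := hl ▸ Nat.find_spec hex
      have hlm : l ≤ m := by
        have : range (l + 1) ⊆ H := fun i hi => hlH i (Nat.lt_succ_iff.1 (mem_range.1 hi))
        have := card_le_card this
        rw [card_range] at this
        omega
      have hlJ : ∃ j, ((l + 1 : ℕ) : ℝ) ≤ u j := ⟨J, by rw [hJ]; exact_mod_cast (by omega)⟩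
      obtain ⟨j, hj⟩ : ∃ j, Nat.find hlJ = j + 1 := by
        refine Nat.exists_eq_succ_of_ne_zero fun h3 => ?_
        have h4 := Nat.find_spec hlJ
        rw [h3] at h4
        push_cast at h4
        have : (0 : ℝ) ≤ l := Nat.cast_nonneg l
        linarith
      have hj1 : ((l + 1 : ℕ) : ℝ) ≤ u (j + 1) := hj ▸ Nat.find_spec hlJ
      have hj2 : u j < (l + 1 : ℕ) := by
        by_contra! h3
        have := Nat.find_min' hlJ h3
        omega
      have hjJ : j < J := by
        by_contra! h3
        have h4 := hu h3
        rw [hJ] at h4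
        have h5 : N + 1 < l + 1 := by exact_mod_cast h4.trans_lt hj2
        omega
      have hlj : (l : ℝ) ≤ u j := by
        have := (hα (σ j)).2
        have := hus j
        push_cast at hj1
        linarith
      have hfl : ⌊u j⌋₊ = l := by
        rw [Nat.floor_eq_iff (hnn j)]
        push_cast at hj2
        exact ⟨hlj, hj2⟩
      have hkj : k j = 0 := by
        simp only [hk, hfl]
        exact if_pos hj1
      have hjH : ¬ e j ⊆ H := fun h3 => by
        refine hlH' (h3 ?_)
        simp only [he, hkj, hfl]
        exact succ_mem_cyclicWindow (har _) (by omega)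
      have hover : overlap u j l = l + 1 - u j := by
        unfold overlap
        have h4 : (l : ℝ) ≤ u (j + 1) := hlj.trans (hlt j).le
        rw [min_eq_right hj1, min_eq_right h4, min_eq_left hj2.le, min_eq_right hlj]
        push_cast
        ring
      have h3 := sum_covered_segments_add_le hu h0 h1 hJ hH hov hjJ hjH (hlH l le_rfl)
      simp only [hseg] at h3
      rw [if_pos h, hover] at h3
      have h4 : ∑ i ∈ range j, α (σ i) ≤ l := by
        by_contra! h4
        obtain ⟨q, hq⟩ := exists_partial_sum_eq (α := α) σ j
        have h5 := hgap l hlm q (hq ▸ h4)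
        have h6 := hstep l (fun E => q E) (by push_cast; rw [← hq]; linarith) (by
          push_cast
          rw [← hq]
          simp only [hu_def] at hj2
          push_cast at hj2
          linarith)
        have h7 : min η (min 1 ε) ≤ ε := (min_le_right _ _).trans (min_le_right _ _)
        push_cast at h6
        linarith
      simp only [hu_def] at h3
      simp at h3
      linarith
  · rw [hδ, filter_true_of_mem, hσ α, card_range]
    · simp only [ht_def]
      push_cast
      linarith
    · intro j hj
      exact cyclicWindow_subset (hn' _) (hcell j (mem_range.1 hj)) (hkQ j)

end Gadget

/-! ### Extensions of small relative rank -/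

section Amalgam

variable {L V : Type} [Fintype L] [DecidableEq V] {α : L → ℝ} {rel : L → Finset V → Prop}

/-- The rank in a free amalgam. -/
lemma delta_add_delta_inter {X Y D : Finset V}
    (h : ∀ E e, rel E e → e ⊆ X ∪ Y → e ⊆ X ∨ e ⊆ Y) (hD : D ⊆ X ∪ Y) :
    delta α rel D + delta α rel (D ∩ (X ∩ Y)) = delta α rel (D ∩ X) + delta α rel (D ∩ Y) := by
  have h1 := delta_union_add_inter_eq (α := α) (rel := rel) (A := D ∩ X) (B := D ∩ Y) (by
    intro E e he heD
    rw [← inter_union_distrib_left] at heD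
    have h2 := heD.trans inter_subset_left
    rcases h E e he (h2.trans hD) with h3 | h3
    · exact Or.inl (subset_inter h2 h3)
    · exact Or.inr (subset_inter h2 h3))
  rwa [← inter_union_distrib_left, inter_eq_left.2 hD, ← inter_inter_distrib_left] at h1

end Amalgam

/-- A finite structure `relG` on `{0, …, n - 1}` can be freely amalgamated over a point. -/
lemma exists_attach {L : Type} {ar : L → ℕ} {rel : L → Finset ℕ → Prop}
    (har : ∀ E, 2 ≤ ar E) (hr : ∀ E e, rel E e → #e = ar E)
    {relG : L → Finset ℕ → Prop} (hrG : ∀ E e, relG E e → #e = ar E) {n : ℕ} (hn : 0 < n)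
    {X : Finset ℕ} {x : ℕ} (hx : x ∈ X) :
    ∃ (rel' : L → Finset ℕ → Prop) (ι : ℕ → ℕ), (∀ E e, rel' E e → #e = ar E) ∧
      (∀ E, ∀ e ⊆ X, (rel' E e ↔ rel E e)) ∧ IsEmb relG rel' (range n) ι ∧ ι 0 = x ∧
      X ∩ (range n).image ι = {x} ∧
      ∀ E e, rel' E e → e ⊆ X ∪ (range n).image ι → e ⊆ X ∨ e ⊆ (range n).image ι := by
  classical
  set B := X.sup id + 1
  set ι : ℕ → ℕ := fun c => if c = 0 then x else B + c with hι
  have hB : ∀ y ∈ X, y < B := fun y hy => Nat.lt_succ_of_le (le_sup (f := id) hy)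
  have h0 : ι 0 = x := rfl
  have hinj : Function.Injective ι := by
    intro a b hab
    have := hB x hx
    simp only [hι] at hab
    split_ifs at hab <;> omega
  have hmem : ∀ c, ι c ∈ X → c = 0 := by
    intro c hc
    have := hB _ hc
    by_contra h
    simp only [hι, if_neg h] at this
    omega
  have hXY : X ∩ (range n).image ι = {x} := by
    ext y
    simp only [mem_inter, mem_image, mem_range, mem_singleton]
    constructor
    · rintro ⟨hy, c, -, rfl⟩
      rw [hmem c hy, h0]
    · rintro rfl
      exact ⟨hx, 0, hn, rfl⟩
  have hcard : ∀ e : Finset ℕ, e.image ι ⊆ X → #e ≤ 1 := by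
    intro e he
    refine card_le_one.2 fun a ha b hb => ?_
    rw [hmem a (he (mem_image_of_mem _ ha)), hmem b (he (mem_image_of_mem _ hb))]
  refine ⟨fun E e => (e ⊆ X ∧ rel E e) ∨ ∃ e' ⊆ range n, relG E e' ∧ e = e'.image ι, ι,
    ?_, ?_, ⟨hinj.injOn, ?_⟩, h0, hXY, ?_⟩
  · rintro E e (h | ⟨e', -, h, rfl⟩)
    · exact hr _ _ h.2
    · rw [card_image_of_injective _ hinj]
      exact hrG _ _ h
  · intro E e he
    constructor
    · rintro (h | ⟨e', -, h, rfl⟩)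
      · exact h.2
      · have h1 := hcard e' he
        have h2 := har E
        rw [hrG E e' h] at h1
        omega
    · exact fun h => Or.inl ⟨he, h⟩
  · intro E e he
    constructor
    · exact fun h => Or.inr ⟨e, he, h, rfl⟩
    · rintro (⟨h, h'⟩ | ⟨e', -, h, h'⟩)
      · have h1 := hcard e h
        have h2 := har E
        have h3 := hr E _ h'
        rw [card_image_of_injective _ hinj] at h3
        omega
      · rwa [image_injective hinj h']
  · rintro E e (h | ⟨e', he', h, rfl⟩) -
    · exact Or.inl h.1
    · exact Or.inr (image_subset_image he')

section Extension

variable {L : Type} [Fintype L] {ar : L → ℕ} {α : L → ℝ} {rel : L → Finset ℕ → Prop}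

/-- `rel'` on `X'` extends `rel` on `X`, keeping `A` strong and making `X` strong in its
extensions by at most `m` points. -/
structure IsExt (ar : L → ℕ) (α : L → ℝ) (m : ℕ) (A : Finset ℕ) (rel : L → Finset ℕ → Prop)
    (X : Finset ℕ) (rel' : L → Finset ℕ → Prop) (X' : Finset ℕ) : Prop where
  card_eq : ∀ E e, rel' E e → #e = ar E
  subset : X ⊆ X'
  rel_iff : ∀ E, ∀ e ⊆ X, (rel' E e ↔ rel E e)
  strong : strong α rel' A X'
  mStrong : mStrong α rel' m X X'

lemma mStrong_congr {rel' : L → Finset ℕ → Prop} {m : ℕ} {A B : Finset ℕ} (hA : A ⊆ B)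
    (h : ∀ E, ∀ e ⊆ B, (rel' E e ↔ rel E e)) (hm : mStrong α rel m A B) :
    mStrong α rel' m A B := by
  intro D h1 h2 h3
  rw [delta_congr (α := α) fun E e he => h E e (he.trans hA),
    delta_congr (α := α) fun E e he => h E e (he.trans h2)]
  exact hm D h1 h2 h3

lemma IsExt.refl (hr : ∀ E e, rel E e → #e = ar E) {m : ℕ} {A X : Finset ℕ}
    (hA : _root_.strong α rel A X) : IsExt ar α m A rel X rel X where
  card_eq := hr
  subset := subset_rfl
  rel_iff _ _ _ := Iff.rfl
  strong := hA
  mStrong D h1 h2 _ := by rw [subset_antisymm h1 h2]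

lemma IsExt.trans (hα : ∀ E, 0 ≤ α E) {m : ℕ} {A X X' X'' : Finset ℕ}
    {rel' rel'' : L → Finset ℕ → Prop} (h : IsExt ar α m A rel X rel' X')
    (h' : IsExt ar α m A rel' X' rel'' X'') : IsExt ar α m A rel X rel'' X'' where
  card_eq := h'.card_eq
  subset := h.subset.trans h'.subset
  rel_iff E e he := (h'.rel_iff E e (he.trans h.subset)).trans (h.rel_iff E e he)
  strong := h'.strong
  mStrong := mStrong.trans hα h.subset h'.subset
    (mStrong_congr h.subset h'.rel_iff h.mStrong) h'.mStrong

/-- Attaching a gadget at `x` lowers by `t` the relative rank of the sets containing `x`. -/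
lemma exists_ext_sub (har : ∀ E, 2 ≤ ar E) (hr : ∀ E e, rel E e → #e = ar E)
    {t : ℝ} {m n : ℕ} {relG : L → Finset ℕ → Prop} (hn : 0 < n)
    (hrG : ∀ E e, relG E e → #e = ar E)
    (hG : ∀ H ⊆ range n, (0 ∉ H → 0 ≤ delta α relG H) ∧ (0 ∈ H → 1 - t ≤ delta α relG H) ∧
        (0 ∈ H → #H ≤ m + 1 → 1 ≤ delta α relG H))
    (hGn : delta α relG (range n) ≤ 1 - t)
    {A X : Finset ℕ} (hAX : strong α rel A X) {x : ℕ} (hx : x ∈ X)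
    (hxt : ∀ D, A ⊆ D → D ⊆ X → x ∈ D → delta α rel A + t ≤ delta α rel D) :
    ∃ (rel' : L → Finset ℕ → Prop) (X' : Finset ℕ), IsExt ar α m A rel X rel' X' ∧
      ∀ D, A ⊆ D → D ⊆ X → x ∈ D → ∃ D', A ⊆ D' ∧ D' ⊆ X' ∧ x ∈ D' ∧
        delta α rel' D' ≤ delta α rel D - t := by
  classical
  obtain ⟨rel', ι, hr', hiff, hemb, h0, hXY, hedge⟩ := exists_attach har hr hrG hn hx
  set Y := (range n).image ι with hY
  have hxY : x ∈ Y := h0 ▸ mem_image_of_mem ι (mem_range.2 hn)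
  have hcongr : ∀ D ⊆ X, delta α rel' D = delta α rel D :=
    fun D hD => delta_congr fun E e he => hiff E e (he.trans hD)
  have hin : ∀ D, x ∈ D → D ∩ (X ∩ Y) = {x} := fun D hxD => by
    rw [hXY, inter_singleton_of_mem hxD]
  have key : ∀ D ⊆ X ∪ Y, (x ∉ D → delta α rel' (D ∩ X) ≤ delta α rel' D) ∧
      (x ∈ D → delta α rel' (D ∩ X) - t ≤ delta α rel' D) ∧
      (x ∈ D → #(D \ X) ≤ m → delta α rel' (D ∩ X) ≤ delta α rel' D) := by
    intro D hD
    have h1 := delta_add_delta_inter (α := α) hedge hD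
    obtain ⟨H, hH, hHD⟩ := exists_image_eq (D := D ∩ Y) (B := range n) (g := ι) inter_subset_right
    have h2 : delta α rel' (D ∩ Y) = delta α relG H := by rw [← hHD, hemb.delta_image hH]
    have h3 : 0 ∈ H ↔ x ∈ D := by
      constructor
      · intro h
        have := mem_image_of_mem ι h
        rw [hHD, h0] at this
        exact (mem_inter.1 this).1
      · intro h
        have : x ∈ H.image ι := hHD ▸ mem_inter.2 ⟨h, hxY⟩
        obtain ⟨c, hc, hcx⟩ := mem_image.1 this
        have : c = 0 := hemb.1 (by exact_mod_cast hH hc) (by simpa using hn) (hcx.trans h0.symm)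
        exact this ▸ hc
    obtain ⟨hG1, hG2, hG3⟩ := hG H hH
    rw [← h2] at hG1 hG2 hG3
    rw [h3] at hG1 hG2 hG3
    refine ⟨fun hxD => ?_, fun hxD => ?_, fun hxD hm => ?_⟩
    · rw [hXY, inter_singleton_of_notMem hxD, delta_empty hr' har] at h1
      linarith [hG1 hxD]
    · rw [hin D hxD, delta_singleton hr' har] at h1
      linarith [hG2 hxD]
    · rw [hin D hxD, delta_singleton hr' har] at h1
      have h4 : #H ≤ m + 1 := by
        have h5 : #H = #(D ∩ Y) := by
          rw [← hHD, card_image_of_injOn (hemb.1.mono (by exact_mod_cast hH))]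
        have h6 : D ∩ Y ⊆ insert x (D \ X) := by
          intro y hy
          rw [mem_inter] at hy
          by_cases hyX : y ∈ X
          · have : y ∈ X ∩ Y := mem_inter.2 ⟨hyX, hy.2⟩
            rw [hXY, mem_singleton] at this
            exact this ▸ mem_insert_self _ _
          · exact mem_insert_of_mem (mem_sdiff.2 ⟨hy.1, hyX⟩)
        have := (card_le_card h6).trans (card_insert_le _ _)
        omega
      linarith [hG3 hxD h4]
  refine ⟨rel', X ∪ Y, ⟨hr', subset_union_left, hiff, ⟨hAX.1.trans subset_union_left, ?_⟩, ?_⟩, ?_⟩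
  · intro D hAD hD
    obtain ⟨h1, h2, -⟩ := key D hD
    rw [hcongr A hAX.1]
    rw [hcongr _ inter_subset_right] at h1 h2
    by_cases hxD : x ∈ D
    · have := hxt (D ∩ X) (subset_inter hAD hAX.1) inter_subset_right (mem_inter.2 ⟨hxD, hx⟩)
      linarith [h2 hxD]
    · have := hAX.2 (D ∩ X) (subset_inter hAD hAX.1) inter_subset_right
      linarith [h1 hxD]
  · intro D hXD hD hm
    have h3 := (key D hD).2.2 (hXD hx) hm
    rwa [inter_eq_right.2 hXD] at h3
  · intro D hAD hD hxD
    refine ⟨D ∪ Y, hAD.trans subset_union_left, union_subset_union hD subset_rfl,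
      mem_union_left _ hxD, ?_⟩
    have h1 := delta_add_delta_inter (α := α) hedge (D := D ∪ Y) (union_subset_union hD subset_rfl)
    have h2 : (D ∪ Y) ∩ X = D := by
      rw [union_inter_distrib_right, inter_eq_left.2 hD, inter_comm Y X, hXY]
      exact union_eq_left.2 (singleton_subset_iff.2 hxD)
    rw [hin _ (mem_union_left _ hxD), delta_singleton hr' har, h2, inter_eq_right.2
      subset_union_right, hcongr D hD, hY, hemb.delta_image subset_rfl] at h1
    linarith

lemma exists_int_delta_sub (α : L → ℝ) (rel : L → Finset ℕ → Prop) (A D : Finset ℕ) :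
    ∃ (p : ℤ) (q : L → ℤ), delta α rel D - delta α rel A = ∑ E, α E * q E - p := by
  refine ⟨#A - #D, fun E => edgeCount rel E A - edgeCount rel E D, ?_⟩
  simp only [delta]
  push_cast
  simp only [mul_sub, Finset.sum_sub_distrib]
  ring

/-- In a suitable extension a given point lies in a set of small relative rank over `A`. -/
lemma exists_ext_mem [Nonempty L] (har : ∀ E, 2 ≤ ar E) (hα : ∀ E, 0 < α E ∧ α E ≤ 1) (m : ℕ)
    {η : ℝ} (hη : 0 < η) (hr : ∀ E e, rel E e → #e = ar E) {A X : Finset ℕ}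
    (hAX : strong α rel A X) {x : ℕ} (hx : x ∈ X) :
    ∃ (rel' : L → Finset ℕ → Prop) (X' : Finset ℕ), IsExt ar α m A rel X rel' X' ∧
      ∃ D, A ⊆ D ∧ D ⊆ X' ∧ x ∈ D ∧ delta α rel' D ≤ delta α rel' A + η := by
  obtain ⟨t, n, relG, ht, hstep, hn, hrG, hG, hGn⟩ := exists_gadget har hα m hη
  have main : ∀ (k : ℕ) (rel : L → Finset ℕ → Prop) (X : Finset ℕ),
      (∀ E e, rel E e → #e = ar E) → strong α rel A X → x ∈ X →
      (∃ D, A ⊆ D ∧ D ⊆ X ∧ x ∈ D ∧ delta α rel D - delta α rel A < k * t) →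
      ∃ (rel' : L → Finset ℕ → Prop) (X' : Finset ℕ), IsExt ar α m A rel X rel' X' ∧
        ∃ D, A ⊆ D ∧ D ⊆ X' ∧ x ∈ D ∧ delta α rel' D ≤ delta α rel' A + η := by
    intro k
    induction k with
    | zero =>
      rintro rel X - hAX - ⟨D, h1, h2, -, h3⟩
      have := hAX.2 D h1 h2
      simp only [Nat.cast_zero, zero_mul] at h3
      linarith
    | succ k ih =>
      rintro rel X hr hAX hx ⟨D, h1, h2, h3, h4⟩
      by_cases hsmall : ∃ D, A ⊆ D ∧ D ⊆ X ∧ x ∈ D ∧ delta α rel D - delta α rel A < t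
      · obtain ⟨D, h1, h2, h3, h4⟩ := hsmall
        refine ⟨rel, X, IsExt.refl hr hAX, D, h1, h2, h3, ?_⟩
        obtain ⟨p, q, hpq⟩ := exists_int_delta_sub α rel A D
        rcases (sub_nonneg.2 (hAX.2 D h1 h2)).eq_or_lt with h5 | h5
        · linarith
        · have := hstep p q (hpq ▸ h5) (hpq ▸ h4)
          linarith
      · push Not at hsmall
        obtain ⟨rel', X', hext, hD⟩ := exists_ext_sub har hr hn hrG hG hGn hAX hx
          fun D h1 h2 h3 => by linarith [hsmall D h1 h2 h3]
        obtain ⟨D', h1', h2', h3', h4'⟩ := hD D h1 h2 h3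
        obtain ⟨rel'', X'', hext', hres⟩ := ih rel' X' hext.card_eq hext.strong (hext.subset hx)
          ⟨D', h1', h2', h3', by
            rw [delta_congr fun E e he => hext.rel_iff E e (he.trans hAX.1)]
            push_cast at h4
            linarith⟩
        exact ⟨rel'', X'', hext.trans (fun E => (hα E).1.le) hext', hres⟩
  obtain ⟨k, hk⟩ := exists_nat_gt ((delta α rel X - delta α rel A) / t)
  rw [div_lt_iff₀ ht] at hk
  exact main k rel X hr hAX hx ⟨X, hAX.1, subset_rfl, hx, hk⟩

/-- A strong extension `C` of `A` has an extension of relative rank at most `η` over `A` in which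
`A` is strong and `C` is strong up to `m` points. -/
theorem exists_ext_delta_le [Nonempty L] (har : ∀ E, 2 ≤ ar E) (hα : ∀ E, 0 < α E ∧ α E ≤ 1)
    (m : ℕ) {η : ℝ} (hη : 0 < η) (hr : ∀ E e, rel E e → #e = ar E) {A C : Finset ℕ}
    (hAC : strong α rel A C) :
    ∃ (rel' : L → Finset ℕ → Prop) (C' : Finset ℕ), IsExt ar α m A rel C rel' C' ∧
      delta α rel' C' ≤ delta α rel' A + η := by
  classical
  have hα' : ∀ E, 0 ≤ α E := fun E => (hα E).1.le
  have main : ∀ S ⊆ C, ∃ (rel' : L → Finset ℕ → Prop) (X : Finset ℕ),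
      IsExt ar α m A rel C rel' X ∧ ∃ D, A ∪ S ⊆ D ∧ D ⊆ X ∧
        delta α rel' D ≤ delta α rel' A + #S * (η / (#C + 1)) := by
    intro S
    induction S using Finset.induction_on with
    | empty =>
      intro _
      exact ⟨rel, C, IsExt.refl hr hAC, A, by simp, hAC.1, by simp⟩
    | insert x S hxS ih =>
      intro hS
      obtain ⟨rel', X, hext, D, h1, h2, h3⟩ := ih ((subset_insert _ _).trans hS)
      obtain ⟨rel'', X', hext', D', h1', h2', h3', h4'⟩ := exists_ext_mem har hα m
        (η := η / (#C + 1)) (by positivity) hext.card_eq hext.strong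
        (hext.subset (hS (mem_insert_self _ _)))
      have hA : A ⊆ D := subset_union_left.trans h1
      have hsub : D ∪ D' ⊆ X' := union_subset (h2.trans hext'.subset) h2'
      refine ⟨rel'', X', hext.trans hα' hext', D ∪ D', ?_, hsub, ?_⟩
      · intro y hy
        rw [mem_union, mem_insert] at hy
        rcases hy with hy | rfl | hy
        · exact mem_union_left _ (hA hy)
        · exact mem_union_right _ h3'
        · exact mem_union_left _ (h1 (mem_union_right _ hy))
      · rw [← delta_congr fun E e he => hext'.rel_iff E e (he.trans h2),
          ← delta_congr fun E e he => hext'.rel_iff E e (he.trans (hA.trans h2))] at h3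
        have h5 := delta_union_add_inter_le (rel := rel'') hα' D D'
        have h6 := hext'.strong.2 (D ∩ D') (subset_inter hA h1')
          (inter_subset_left.trans (h2.trans hext'.subset))
        rw [card_insert_of_notMem hxS]
        push_cast
        linarith
  obtain ⟨rel', X, hext, D, h1, h2, h3⟩ := main C subset_rfl
  refine ⟨rel', D, ⟨hext.card_eq, subset_union_right.trans h1, hext.rel_iff,
    ⟨subset_union_left.trans h1, fun F hF hFD => hext.strong.2 F hF (hFD.trans h2)⟩,
    fun F hF hFD => hext.mStrong F hF (hFD.trans h2)⟩, h3.trans ?_⟩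
  have : (#C : ℝ) * (η / (#C + 1)) ≤ η := by
    rw [mul_div_assoc', div_le_iff₀ (by positivity)]
    linarith
  linarith

end Extension

/-! ### Closures -/

lemma edgeCount_mono {L V : Type} {rel : L → Finset V → Prop} {A B : Finset V} (h : A ⊆ B) (E : L) :
    edgeCount rel E A ≤ edgeCount rel E B := by
  refine Set.ncard_le_ncard (fun e he => ⟨he.1.trans h, he.2⟩) ?_
  exact (B.powerset.finite_toSet).subset fun e he => mem_coe.2 (mem_powerset.2 he.1)

section Closure

variable {L : Type} [Fintype L] {α : L → ℝ}

/-- Every set whose extensions by at most `B` points do not lose more than `β` in rank has a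
closure, strong up to `m` points, obtained by adding at most `B` points. -/
lemma exists_closure (hα : ∀ E, 0 < α E) (m : ℕ) :
    ∃ θ : ℝ, 0 < θ ∧ ∀ {V : Type} [DecidableEq V] (rel : L → Finset V → Prop) (Z : Finset V)
      (B : ℕ) (β : ℝ), β / θ + m ≤ B →
      (∀ Y, Z ⊆ Y → #(Y \ Z) ≤ B → delta α rel Z - β ≤ delta α rel Y) →
      ∃ X, Z ⊆ X ∧ (∀ F, mStrong α rel m X F) ∧ #(X \ Z) ≤ B ∧
        θ * #(X \ Z) ≤ delta α rel Z - delta α rel X := by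
  obtain ⟨ε, hε, hgap⟩ := exists_gap hα m
  have hθ : 0 < ε / (m + 1) := by positivity
  refine ⟨ε / (m + 1), hθ, fun {V} _ rel Z B β hB hβ => ?_⟩
  have hdrop : ∀ X D : Finset V, X ⊆ D → #(D \ X) ≤ m → delta α rel D < delta α rel X →
      delta α rel D ≤ delta α rel X - ε := by
    intro X D hXD hm hlt
    have h1 := hgap #(D \ X) hm fun E => edgeCount rel E D - edgeCount rel E X
    have h2 : ∑ E, α E * ((edgeCount rel E D - edgeCount rel E X : ℕ) : ℝ) - (#(D \ X) : ℝ) =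
        delta α rel X - delta α rel D := by
      have h3 : (#(D \ X) : ℝ) = #D - #X := by
        rw [card_sdiff_of_subset hXD, Nat.cast_sub (card_le_card hXD)]
      rw [h3]
      simp only [Nat.cast_sub (edgeCount_mono hXD _), mul_sub, Finset.sum_sub_distrib, delta]
      ring
    linarith [h1 (by linarith)]
  by_contra! hcon
  have main : ∀ k : ℕ, ∃ X, Z ⊆ X ∧ k ≤ #(X \ Z) ∧ #(X \ Z) ≤ B ∧
      ε / (m + 1) * #(X \ Z) ≤ delta α rel Z - delta α rel X := by
    intro k
    induction k with
    | zero => exact ⟨Z, subset_rfl, Nat.zero_le _, by simp, by simp⟩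
    | succ k ih =>
      obtain ⟨X, hZX, hk, hXB, hX⟩ := ih
      have hns : ¬ ∀ F, mStrong α rel m X F := fun h => (hcon X hZX h hXB).not_ge hX
      simp only [mStrong] at hns
      push Not at hns
      obtain ⟨-, D, hXD, -, hm, hlt⟩ := hns
      have h1 := hdrop X D hXD hm hlt
      have h2 : #(D \ Z) = #(X \ Z) + #(D \ X) := by
        rw [card_sdiff_of_subset (hZX.trans hXD), card_sdiff_of_subset hZX,
          card_sdiff_of_subset hXD]
        have := card_le_card hXD
        have := card_le_card hZX
        omega
      have h3 : ε / (m + 1) * #(D \ X) ≤ ε := by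
        have h4 : (#(D \ X) : ℝ) ≤ m := by exact_mod_cast hm
        rw [div_mul_eq_mul_div, div_le_iff₀ (by positivity)]
        nlinarith
      have h4 : 0 < #(D \ X) := by
        refine card_pos.2 (nonempty_iff_ne_empty.2 fun h => ?_)
        rw [subset_antisymm hXD (sdiff_eq_empty_iff_subset.1 h)] at hlt
        exact lt_irrefl _ hlt
      refine ⟨D, hZX.trans hXD, by omega, ?_, ?_⟩
      · have h5 := hβ X hZX hXB
        have h6 : (#(X \ Z) : ℝ) ≤ β / (ε / (m + 1)) := by
          rw [le_div_iff₀ hθ]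
          linarith
        have h7 : ((#(X \ Z) + #(D \ X) : ℕ) : ℝ) ≤ B := by
          push_cast
          have : (#(D \ X) : ℝ) ≤ m := by exact_mod_cast hm
          linarith
        rw [h2]
        exact_mod_cast h7
      · rw [h2]
        push_cast
        linarith
  obtain ⟨X, -, h1, h2, -⟩ := main (B + 1)
  omega

end Closure

/-! ### Strong extensions up to finitely many points -/

section Copies

variable {L : Type} [Fintype L] {ar : L → ℕ} {α : L → ℝ}

/-- Freely amalgamated copies of a structure over a strong substructure. -/
lemma exists_copies {rel : L → Finset ℕ → Prop} (hr : ∀ E e, rel E e → #e = ar E)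
    {A C : Finset ℕ} (hAC : strong α rel A C) {η : ℝ}
    (hη : delta α rel C ≤ delta α rel A + η) (n : ℕ) (hn : 0 < n) :
    ∃ (rel' : L → Finset ℕ → Prop) (Z : Finset ℕ) (ι : ℕ → ℕ → ℕ),
      (∀ E e, rel' E e → #e = ar E) ∧ strong α rel' A Z ∧
      (∀ E, ∀ e ⊆ A, (rel' E e ↔ rel E e)) ∧
      delta α rel' Z ≤ delta α rel' A + n * η ∧
      (∀ i < n, IsEmb rel rel' C (ι i) ∧ (∀ a ∈ A, ι i a = a) ∧ C.image (ι i) ⊆ Z) ∧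
      (∀ i j, i ≠ j → C.image (ι i) ∩ C.image (ι j) ⊆ A) ∧
      ∀ E e, rel' E e → ∃ i < n, e ⊆ C.image (ι i) := by
  classical
  set K := A.sup id + 1
  have hK : ∀ a ∈ A, a < K := fun a ha => Nat.lt_succ_of_le (le_sup (f := id) ha)
  set ι : ℕ → ℕ → ℕ := fun i c => if c ∈ A then c else K + Nat.pair i c with hι
  have hι_eq : ∀ i j c d, ι i c = ι j d → c = d ∧ (c ∈ A ∨ i = j) := by
    intro i j c d h
    simp only [hι] at h
    split_ifs at h with h1 h2 h2
    · exact ⟨h, Or.inl h1⟩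
    · have := hK c h1
      omega
    · have := hK d h2
      omega
    · have := Nat.pair_eq_pair.1 (Nat.add_left_cancel h)
      exact ⟨this.2, Or.inr this.1⟩
  have hinj : ∀ i, Function.Injective (ι i) := fun i c d h => (hι_eq i i c d h).1
  have hιA : ∀ i, ∀ a ∈ A, ι i a = a := fun i a ha => if_pos ha
  have himA : ∀ i, ∀ e ⊆ A, e.image (ι i) = e := fun i e he => by
    rw [image_congr (g := id) fun a ha => hιA i a (he ha), image_id]
  have hAY : ∀ i, A ⊆ C.image (ι i) := fun i a ha =>
    mem_image.2 ⟨a, hAC.1 ha, hιA i a ha⟩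
  have hpre : ∀ i j c, i ≠ j → ι i c ∈ C.image (ι j) → c ∈ A := by
    intro i j c hij h
    obtain ⟨d, -, hd⟩ := mem_image.1 h
    obtain ⟨rfl, h1⟩ := hι_eq _ _ _ _ hd
    exact h1.resolve_right hij.symm
  have hdisj : ∀ i j, i ≠ j → C.image (ι i) ∩ C.image (ι j) ⊆ A := by
    intro i j hij x hx
    obtain ⟨h1, h2⟩ := mem_inter.1 hx
    obtain ⟨c, -, rfl⟩ := mem_image.1 h1
    have := hpre i j c hij h2
    rwa [hιA i c this]
  set rel' : L → Finset ℕ → Prop := fun E e => ∃ i < n, ∃ e' ⊆ C, rel E e' ∧ e = e'.image (ι i)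
    with hrel'
  have hemb : ∀ i < n, IsEmb rel rel' C (ι i) := by
    refine fun i hi => ⟨(hinj i).injOn, fun E e he => ⟨fun h => ⟨i, hi, e, he, h, rfl⟩, ?_⟩⟩
    rintro ⟨j, -, e', he', h, h'⟩
    rcases eq_or_ne i j with rfl | hij
    · rwa [image_injective (hinj i) h']
    · have h1 : e ⊆ A := fun c hc => hpre i j c hij
        (image_subset_image he' (h' ▸ mem_image_of_mem _ hc))
      have h2 : e' ⊆ A := fun c hc => hpre j i c hij.symm
        (image_subset_image he (h' ▸ mem_image_of_mem _ hc))
      rw [himA i e h1, himA j e' h2] at h'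
      rwa [h']
  have hedge : ∀ E e, rel' E e → ∃ i < n, e ⊆ C.image (ι i) := by
    rintro E _ ⟨i, hi, e', he', -, rfl⟩
    exact ⟨i, hi, image_subset_image he'⟩
  have hiff : ∀ E, ∀ e ⊆ A, (rel' E e ↔ rel E e) := fun E e he => by
    rw [(hemb 0 hn).2 E e (he.trans hAC.1), himA 0 e he]
  have hstr : ∀ i < n, ∀ D ⊆ C.image (ι i), A ⊆ D → delta α rel' A ≤ delta α rel' D := by
    intro i hi D hD hAD
    have h1 := hAC.2
    obtain ⟨D', hD', rfl⟩ := exists_image_eq hD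
    rw [(hemb i hi).delta_image hD', delta_congr fun E e he => hiff E e he]
    refine hAC.2 D' (fun a ha => ?_) hD'
    obtain ⟨c, hc, hca⟩ := mem_image.1 (hAD ha)
    rw [← hιA i a ha] at hca
    exact hinj i hca ▸ hc
  have main : ∀ k ≤ n, strong α rel' A (A ∪ (range k).biUnion fun i => C.image (ι i)) ∧
      delta α rel' (A ∪ (range k).biUnion fun i => C.image (ι i)) ≤
        delta α rel' A + k * η := by
    intro k
    induction k with
    | zero =>
      refine fun _ => ⟨⟨by simp, fun D h1 h2 => ?_⟩, by simp⟩
      rw [range_zero, biUnion_empty, union_empty] at h2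
      rw [subset_antisymm h1 h2]
    | succ k ih =>
      intro hk
      obtain ⟨ih1, ih2⟩ := ih (by omega)
      set Zk := A ∪ (range k).biUnion fun i => C.image (ι i) with hZk
      have hZ : A ∪ (range (k + 1)).biUnion (fun i => C.image (ι i)) = Zk ∪ C.image (ι k) := by
        rw [range_add_one, biUnion_insert, hZk]
        ext x
        simp only [mem_union]
        tauto
      have hY : ∀ i, k ≤ i → Zk ∩ C.image (ι i) = A := by
        intro i hi
        apply subset_antisymm
        · intro x hx
          obtain ⟨h1, h2⟩ := mem_inter.1 hx
          rcases mem_union.1 h1 with h1 | h1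
          · exact h1
          · obtain ⟨j, hj, h1⟩ := mem_biUnion.1 h1
            rw [mem_range] at hj
            exact hdisj j i (by omega) (mem_inter.2 ⟨h1, h2⟩)
        · exact subset_inter subset_union_left (hAY i)
      have hsplit : ∀ E e, rel' E e → e ⊆ Zk ∪ C.image (ι k) → e ⊆ Zk ∨ e ⊆ C.image (ι k) := by
        intro E e he heZ
        obtain ⟨i, -, hei⟩ := hedge E e he
        rcases lt_trichotomy i k with h | rfl | h
        · left
          exact hei.trans ((subset_biUnion_of_mem (fun i => C.image (ι i))
            (mem_range.2 h)).trans subset_union_right)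
        · exact Or.inr hei
        · left
          intro x hx
          rcases mem_union.1 (heZ hx) with h1 | h1
          · exact h1
          · exact mem_union_left _ (hdisj k i h.ne (mem_inter.2 ⟨h1, hei hx⟩))
      rw [hZ]
      have hsum : ∀ D, A ⊆ D → D ⊆ Zk ∪ C.image (ι k) → delta α rel' D + delta α rel' A =
          delta α rel' (D ∩ Zk) + delta α rel' (D ∩ C.image (ι k)) := by
        intro D hAD hD
        rw [← delta_add_delta_inter hsplit hD, hY k le_rfl, inter_eq_right.2 hAD]
      refine ⟨⟨subset_union_left.trans subset_union_left, fun D hAD hD => ?_⟩, ?_⟩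
      · have h1 := hsum D hAD hD
        have h2 := ih1.2 (D ∩ Zk) (subset_inter hAD subset_union_left) inter_subset_right
        have h3 := hstr k hk _ (inter_subset_right (s₁ := D)) (subset_inter hAD (hAY k))
        linarith
      · have h1 := hsum _ (subset_union_left.trans subset_union_left) subset_rfl
        rw [inter_eq_right.2 subset_union_left, inter_eq_right.2 subset_union_right,
          (hemb k hk).delta_image subset_rfl] at h1
        rw [← delta_congr fun E e he => hiff E e he] at hη
        push_cast
        linarith
  refine ⟨rel', _, ι, ?_, (main n le_rfl).1, hiff, (main n le_rfl).2,
    fun i hi => ⟨hemb i hi, hιA i, ?_⟩, hdisj, hedge⟩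
  · rintro E _ ⟨i, -, e', -, h, rfl⟩
    rw [card_image_of_injective _ (hinj i)]
    exact hr E e' h
  · exact (subset_biUnion_of_mem (fun i => C.image (ι i)) (mem_range.2 hi)).trans
      subset_union_right

end Copies

section Counting

variable {L V : Type} [Fintype L] [DecidableEq V] {α : L → ℝ} {rel : L → Finset V → Prop}

/-- Among sufficiently many extensions `S i` of `A`, freely amalgamated over `A` inside a set `Z`
of small rank, one is strong up to `m` points. -/
lemma exists_copy_mStrong {θ a η : ℝ} {m n r : ℕ} (ha : 0 < a) (hle : ∀ E, a ≤ α E)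
    (hr : ∀ E e, rel E e → #e ≤ r) (hpos : ∀ D, 0 ≤ delta α rel D) (hθ : 0 < θ)
    (hcl : ∀ (Z : Finset V) (B : ℕ) (β : ℝ), β / θ + m ≤ B →
      (∀ Y, Z ⊆ Y → #(Y \ Z) ≤ B → delta α rel Z - β ≤ delta α rel Y) →
      ∃ X, Z ⊆ X ∧ (∀ F, mStrong α rel m X F) ∧ #(X \ Z) ≤ B ∧
        θ * #(X \ Z) ≤ delta α rel Z - delta α rel X)
    {A Z : Finset V} {S Y : Fin n → Finset V} (hA : ∀ F, mStrong α rel m A F)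
    (hAS : ∀ i, A ⊆ S i) (hSY : ∀ i, S i ⊆ Y i) (hYZ : ∀ i, Y i ⊆ Z)
    (hS : ∀ i, mStrong α rel m (S i) (Y i)) (hY : ∀ i j, i ≠ j → Y i ∩ Y j ⊆ A)
    (hedge : ∀ E, ∀ e ⊆ Z, rel E e → ∃ i, e ⊆ Y i)
    (hZ : delta α rel Z ≤ delta α rel A + n * η)
    (hbig : r * ((delta α rel A + n * η) * (1 + 1 / θ)) < a * n) :
    ∃ i, ∀ F, mStrong α rel m (S i) F := by
  classical
  by_contra! hcon
  obtain ⟨B, hB⟩ := exists_nat_ge (delta α rel Z / θ + m)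
  obtain ⟨X, hZX, hXm, -, hX⟩ := hcl Z B (delta α rel Z) hB fun Y _ _ => by
    rw [sub_self]
    exact hpos Y
  have hSX : ∀ i, S i ⊆ X := fun i => (hSY i).trans ((hYZ i).trans hZX)
  have hbad : ∀ i, ∃ D, S i ⊆ D ∧ D ⊆ X ∧ #(D \ S i) ≤ m ∧
      delta α rel D < delta α rel (S i) := by
    intro i
    have hex : ∃ k D, S i ⊆ D ∧ #(D \ S i) ≤ m ∧ delta α rel D < delta α rel (S i) ∧ #D = k := by
      obtain ⟨F, hF⟩ := hcon i
      simp only [mStrong] at hF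
      push Not at hF
      obtain ⟨D, h1, -, h2, h3⟩ := hF
      exact ⟨_, D, h1, h2, h3, rfl⟩
    obtain ⟨D, h1, h2, h3, h4⟩ := Nat.find_spec hex
    refine ⟨D, h1, ?_, h2, h3⟩
    by_contra hDX
    have h6 : #(D ∩ X) < #D := card_lt_card
      ⟨inter_subset_left, fun h => hDX (h.trans inter_subset_right)⟩
    have h7 : delta α rel (D ∩ X) ≤ delta α rel D :=
      (hXm (D ∪ X)).delta_inter_le (fun E => ha.le.trans (hle E)) subset_union_right
        subset_union_left ((card_le_card (sdiff_subset_sdiff subset_rfl (hSX i))).trans h2)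
    refine Nat.find_min hex (h4 ▸ h6) ⟨D ∩ X, subset_inter h1 (hSX i), ?_, h7.trans_lt h3, rfl⟩
    exact (card_le_card (sdiff_subset_sdiff inter_subset_left subset_rfl)).trans h2
  have hcross : ∀ i, ∃ (p : L × Finset V) (x : V),
      p ∈ edges rel X \ edges rel Z ∧ x ∈ p.2 ∧ x ∈ Y i ∧ x ∉ A := by
    intro i
    obtain ⟨D, h1, h2, h3, h4⟩ := hbad i
    have hAD := (hAS i).trans h1
    have hAY := (hAS i).trans (hSY i)
    have hDeq : D ∩ Y i ∪ (A ∪ D \ Y i) = D := by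
      ext x
      simp only [mem_union, mem_inter, mem_sdiff]
      have := @hAD x
      tauto
    have hinter : D ∩ Y i ∩ (A ∪ D \ Y i) = A := by
      ext x
      simp only [mem_union, mem_inter, mem_sdiff]
      have := @hAD x
      have := @hAY x
      tauto
    have hex : ∃ E e, rel E e ∧ e ⊆ D ∧ ¬ e ⊆ D ∩ Y i ∧ ¬ e ⊆ A ∪ D \ Y i := by
      by_contra! hno
      have h5 := delta_union_add_inter_eq (α := α) (rel := rel) (A := D ∩ Y i)
        (B := A ∪ D \ Y i) fun E e he heD => by
          rw [hDeq] at heD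
          by_cases h : e ⊆ D ∩ Y i
          · exact Or.inl h
          · exact Or.inr (hno E e he heD h)
      rw [hDeq, hinter] at h5
      have h6 := hS i (D ∩ Y i) (subset_inter h1 (hSY i)) inter_subset_right
        ((card_le_card (sdiff_subset_sdiff inter_subset_left subset_rfl)).trans h3)
      have h7 := hA _ (A ∪ D \ Y i) subset_union_left subset_rfl (by
        refine (card_le_card ?_).trans h3
        intro x
        simp only [mem_union, mem_sdiff]
        have := @hSY i x
        tauto)
      linarith
    obtain ⟨E, e, he, heD, h5, h6⟩ := hex
    obtain ⟨x, hxe, hx⟩ := not_subset.1 h6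
    simp only [mem_union, mem_sdiff, not_or, not_and, not_not] at hx
    have hxY := hx.2 (heD hxe)
    refine ⟨(E, e), x, ?_, hxe, hxY, hx.1⟩
    simp only [mem_sdiff, mem_edges]
    refine ⟨⟨heD.trans h2, he⟩, fun ⟨h7, _⟩ => ?_⟩
    obtain ⟨j, hej⟩ := hedge E e h7 he
    rcases eq_or_ne i j with rfl | hij
    · exact h5 (subset_inter heD hej)
    · exact hx.1 (hY i j hij (mem_inter.2 ⟨hxY, hej hxe⟩))
  choose p x hp hxp hxY hxA using hcross
  set T := edges rel X \ edges rel Z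
  have hcount : n ≤ r * #T := by
    have h1 := card_le_mul_card_image_of_maps_to (s := (univ : Finset (Fin n))) (t := T) (f := p)
      (fun i _ => hp i) r fun q hq => by
        have hinj : Set.InjOn x ↑({i ∈ (univ : Finset (Fin n)) | p i = q}) := by
          intro i _ j _ hij
          by_contra hne
          exact hxA i (hY i j hne (mem_inter.2 ⟨hxY i, hij ▸ hxY j⟩))
        refine (card_le_card_of_injOn x (t := q.2) ?_ hinj).trans
          (hr q.1 q.2 (mem_edges.1 (mem_sdiff.1 hq).1).2)
        intro i hi
        have hiq := (mem_filter.1 (mem_coe.1 hi)).2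
        exact mem_coe.2 (hiq ▸ hxp i)
    rwa [card_univ, Fintype.card_fin] at h1
  have hsum : ∑ q ∈ T, α q.1 = delta α rel Z - delta α rel X + #(X \ Z) := by
    have h1 := Finset.sum_sdiff (edges_mono (rel := rel) hZX) (f := fun q => α q.1)
    have h2 : (#(X \ Z) : ℝ) = #X - #Z := by
      rw [card_sdiff_of_subset hZX, Nat.cast_sub (card_le_card hZX)]
    rw [delta_eq, delta_eq]
    linarith
  have hT : a * #T ≤ ∑ q ∈ T, α q.1 := by
    rw [mul_comm, ← nsmul_eq_mul]
    exact Finset.card_nsmul_le_sum _ _ _ fun q _ => hle q.1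
  have h1 := hpos X
  have h2 : (#(X \ Z) : ℝ) ≤ delta α rel Z / θ := by
    rw [le_div_iff₀ hθ]
    linarith
  have h3 : a * #T ≤ (delta α rel A + n * η) * (1 + 1 / θ) := by
    have : delta α rel Z * (1 + 1 / θ) ≤ (delta α rel A + n * η) * (1 + 1 / θ) := by gcongr
    have h4 : delta α rel Z * (1 + 1 / θ) = delta α rel Z + delta α rel Z / θ := by ring
    linarith
  have h4 : (n : ℝ) ≤ r * #T := by exact_mod_cast hcount
  have h5 : a * n ≤ r * (a * #T) := by nlinarith
  have h6 : (r : ℝ) * (a * #T) ≤ r * ((delta α rel A + n * η) * (1 + 1 / θ)) := by gcongr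
  linarith

end Counting

/-! ### Strong embeddings into models -/

lemma image_image_of_leftInvOn {S T : Type} [DecidableEq S] [DecidableEq T] {f : S → T} {g : T → S}
    {X e : Finset S} (h : ∀ x ∈ X, g (f x) = x) (he : e ⊆ X) : (e.image f).image g = e := by
  rw [image_image]
  exact (image_congr fun x hx => h x (he hx)).trans image_id

/-- A finite structure can be copied to the natural numbers. -/
lemma exists_encoding {L V : Type} {ar : L → ℕ} [DecidableEq V] [Nonempty V]
    {rel : L → Finset V → Prop} (hr : ∀ E e, rel E e → #e = ar E) (X : Finset V) :
    ∃ (cod : V → ℕ) (dec : ℕ → V) (rel' : L → Finset ℕ → Prop), (∀ x ∈ X, dec (cod x) = x) ∧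
      (∀ E e, rel' E e → #e = ar E) ∧ IsEmb rel' rel (X.image cod) dec ∧
      IsEmb rel rel' X cod := by
  classical
  let v₀ : V := Classical.arbitrary V
  let cod : V → ℕ := fun x => if h : x ∈ X then X.equivFin ⟨x, h⟩ else 0
  let dec : ℕ → V := fun i => if h : i < #X then X.equivFin.symm ⟨i, h⟩ else v₀
  have hdc : ∀ x ∈ X, dec (cod x) = x := fun x hx => by simp [cod, dec, hx]
  have hcod : Set.InjOn cod ↑X := fun x hx y hy h => by rw [← hdc x hx, ← hdc y hy, h]
  have hdec : Set.InjOn dec ↑(X.image cod) := by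
    intro i hi j hj h
    obtain ⟨x, hx, rfl⟩ := mem_image.1 (mem_coe.1 hi)
    obtain ⟨y, hy, rfl⟩ := mem_image.1 (mem_coe.1 hj)
    rw [hdc x hx, hdc y hy] at h
    rw [h]
  have himg : ∀ e ⊆ X, (e.image cod).image dec = e := fun e he =>
    image_image_of_leftInvOn hdc he
  refine ⟨cod, dec, fun E e => e ⊆ X.image cod ∧ rel E (e.image dec), hdc, ?_, ⟨hdec, ?_⟩,
    hcod, ?_⟩
  · rintro E e ⟨h1, h2⟩
    rw [← hr E _ h2, card_image_of_injOn (hdec.mono (by exact_mod_cast h1))]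
  · exact fun E e he => ⟨fun h => h.2, fun h => ⟨he, h⟩⟩
  · intro E e he
    show _ ↔ _ ∧ rel E ((e.image cod).image dec)
    rw [himg e he]
    exact ⟨fun h => ⟨image_subset_image he, h⟩, fun h => h.2⟩

section Models

variable {L : Type} {ar : L → ℕ} {V : Type} [DecidableEq V] [(hypLang L ar).Structure V]

lemma relOf_card {E : L} {e : Finset V} (h : relOf L ar V E e) : #e = ar E := by
  obtain ⟨x, hx, rfl, -⟩ := h
  rw [card_image_of_injective _ hx, card_univ, Fintype.card_fin]

lemma relMap_iff (hp : properStructure L ar V) (E : L) (x : Fin (ar E) → V) :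
    @Structure.RelMap (hypLang L ar) V _ (ar E) ⟨E, rfl⟩ x ↔
      Function.Injective x ∧ relOf L ar V E (univ.image x) := by
  constructor
  · intro h
    have := (hp _ _ x).1 h
    exact ⟨this, x, this, rfl, h⟩
  · rintro ⟨hx, y, hy, hyx, h⟩
    have hrange : Set.range x = Set.range y := by
      have := congrArg (fun s : Finset V => (s : Set V)) hyx
      simpa using this.symm
    let σ : Equiv.Perm (Fin (ar E)) := (Equiv.ofInjective x hx).trans
      ((Equiv.setCongr hrange).trans (Equiv.ofInjective y hy).symm)
    have hσ : y ∘ σ = x := by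
      funext i
      have := Equiv.apply_ofInjective_symm hy
        (Equiv.setCongr hrange (Equiv.ofInjective x hx i))
      simpa [σ] using this
    rw [← hσ]
    exact (hp _ _ y).2 σ h

end Models

section Extend

variable {L : Type} [Fintype L] [Nonempty L] {ar : L → ℕ} {α : L → ℝ} {V : Type} [DecidableEq V]
  [(hypLang L ar).Structure V]

/-- An embedding of `A ≤ C` onto a set that is strong up to `m` points extends to such an
embedding of `C`. -/
theorem exists_mStrong_extension (har : ∀ E, 2 ≤ ar E) (hα : ∀ E, 0 < α E ∧ α E ≤ 1)
    (hmod : modelsSalpha L ar α V) (m : ℕ) {rel : L → Finset ℕ → Prop}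
    (hr : ∀ E e, rel E e → #e = ar E) {A C : Finset ℕ} (hAC : strong α rel A C)
    {f : ℕ → V} (hf : IsEmb rel (relOf L ar V) A f)
    (hm : ∀ F, mStrong α (relOf L ar V) m (A.image f) F) :
    ∃ g : ℕ → V, IsEmb rel (relOf L ar V) C g ∧ (∀ x ∈ A, g x = f x) ∧
      ∀ F, mStrong α (relOf L ar V) m (C.image g) F := by
  have hα' : ∀ E, 0 ≤ α E := fun E => (hα E).1.le
  have hpos : ∀ D, 0 ≤ delta α (relOf L ar V) D := fun D => hmod.2.1 D D subset_rfl
  obtain ⟨a, ha, hle⟩ := exists_pos_lower_bound fun E => (hα E).1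
  obtain ⟨θ, hθ, hcl⟩ := exists_closure (fun E => (hα E).1) m
  set r := ∑ E, ar E with hr_def
  have har_le : ∀ E, ar E ≤ r := fun E =>
    Finset.single_le_sum (f := ar) (fun _ _ => Nat.zero_le _) (mem_univ E)
  set κ := 1 + 1 / θ with hκ
  have hκ0 : 0 < κ := by positivity
  have hr0 : (0 : ℝ) < r := by
    obtain ⟨E⟩ := ‹Nonempty L›
    have := har E
    have := har_le E
    exact_mod_cast (by omega : 0 < r)
  obtain ⟨rel₁, C₁, hext, hd⟩ := exists_ext_delta_le har hα m (η := a / (2 * r * κ))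
    (by positivity) hr hAC
  obtain ⟨n, hn⟩ := exists_nat_gt (2 * r * κ * delta α rel A / a)
  have hδA : 0 ≤ delta α rel A := by
    rw [← hf.delta_image subset_rfl]
    exact hpos _
  have hn0 : 0 < n := by
    have : (0 : ℝ) < n := lt_of_le_of_lt (by positivity) hn
    exact_mod_cast this
  obtain ⟨rel₂, Z, ι, hr₂, hAZ, hiff, hδZ, hι, hdisj, hedge⟩ :=
    exists_copies hext.card_eq hext.strong hd n hn0
  have hiff' : ∀ E, ∀ e ⊆ A, (rel₂ E e ↔ rel E e) := fun E e he =>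
    (hiff E e he).trans (hext.rel_iff E e (he.trans hAC.1))
  have hf₂ : IsEmb rel₂ (relOf L ar V) A f :=
    ⟨hf.1, fun E e he => (hiff' E e he).trans (hf.2 E e he)⟩
  obtain ⟨g, hg1, hgf, hg2⟩ := hmod.2.2 rel₂ hr₂ A Z hAZ.1
    (hAZ.inK hα' (hf₂.inK_of_image (hmod.2.1 _))) hAZ f hf₂.1 hf₂.2
  have hg : IsEmb rel₂ (relOf L ar V) Z g := ⟨hg1, hg2⟩
  have hG : ∀ i < n, IsEmb rel₁ (relOf L ar V) C₁ (g ∘ ι i) := fun i hi =>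
    hg.comp (hι i hi).1 (hι i hi).2.2
  have hGA : ∀ i < n, ∀ x ∈ A, (g ∘ ι i) x = f x := fun i hi x hx => by
    rw [Function.comp_apply, (hι i hi).2.1 x hx, hgf x hx]
  obtain ⟨i, hi⟩ : ∃ i : Fin n, ∀ F, mStrong α (relOf L ar V) m (C.image (g ∘ ι i)) F := by
    refine exists_copy_mStrong (θ := θ) (η := a / (2 * r * κ)) (n := n)
      (A := A.image f) (Z := Z.image g) (S := fun i => C.image (g ∘ ι i))
      (Y := fun i => C₁.image (g ∘ ι i)) ha hle
      (fun E e he => (relOf_card he).le.trans (har_le E)) hpos hθ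
      (fun Z B β => hcl (relOf L ar V) Z B β) hm ?_ ?_ ?_ ?_ ?_ ?_ ?_ ?_
    · intro i y hy
      obtain ⟨x, hx, rfl⟩ := mem_image.1 hy
      exact mem_image.2 ⟨x, hAC.1 hx, hGA i i.2 x hx⟩
    · exact fun i => image_subset_image hext.subset
    · intro i
      rw [← image_image]
      exact image_subset_image (hι i i.2).2.2
    · exact fun i => (hG i i.2).mStrong_image hext.subset hext.mStrong
    · intro i j hij y hy
      obtain ⟨h1, h2⟩ := mem_inter.1 hy
      obtain ⟨c, hc, rfl⟩ := mem_image.1 h1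
      obtain ⟨d, hd, hdc⟩ := mem_image.1 h2
      have h3 := mem_image_of_mem (ι i) hc
      have h4 := mem_image_of_mem (ι j) hd
      have h5 : ι j d = ι i c := hg1 ((hι j j.2).2.2 h4) ((hι i i.2).2.2 h3) hdc
      have h6 := hdisj i j (fun h => hij (Fin.ext h)) (mem_inter.2 ⟨h3, h5 ▸ h4⟩)
      exact mem_image.2 ⟨_, h6, (hgf _ h6).symm⟩
    · intro E e he h
      obtain ⟨e', he', rfl⟩ := exists_image_eq he
      obtain ⟨i, hi, hei⟩ := hedge E e' ((hg.2 E e' he').2 h)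
      refine ⟨⟨i, hi⟩, ?_⟩
      rw [← image_image]
      exact image_subset_image hei
    · rw [hg.delta_image subset_rfl, hf₂.delta_image subset_rfl]
      exact hδZ
    · rw [hf.delta_image subset_rfl]
      rw [div_lt_iff₀ ha] at hn
      have : (r : ℝ) * ((delta α rel A + n * (a / (2 * r * κ))) * κ) =
          (2 * r * κ * delta α rel A) / 2 + n * a / 2 := by
        field_simp
      rw [← hκ, this]
      linarith
  refine ⟨g ∘ ι i, ⟨(hG i i.2).1.mono (by exact_mod_cast hext.subset), fun E e he => ?_⟩,
    hGA i i.2, hi⟩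
  rw [← (hG i i.2).2 E e (he.trans hext.subset), hext.rel_iff E e he]

/-- The version of `exists_mStrong_extension` for strong extensions inside the model. -/
lemma exists_mStrong_extension_of_strong (har : ∀ E, 2 ≤ ar E) (hα : ∀ E, 0 < α E ∧ α E ≤ 1)
    (hmod : modelsSalpha L ar α V) [Nonempty V] (m : ℕ) {C X : Finset V}
    (hCX : strong α (relOf L ar V) C X) {f : V → V}
    (hf : IsEmb (relOf L ar V) (relOf L ar V) C f)
    (hm : ∀ F, mStrong α (relOf L ar V) m (C.image f) F) :
    ∃ g : V → V, IsEmb (relOf L ar V) (relOf L ar V) X g ∧ (∀ x ∈ C, g x = f x) ∧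
      ∀ F, mStrong α (relOf L ar V) m (X.image g) F := by
  obtain ⟨cod, dec, rel, hdc, hr, hdec, hcod⟩ :=
    exists_encoding (ar := ar) (rel := relOf L ar V) (fun E e => relOf_card) X
  have himg : ∀ e ⊆ X, (e.image cod).image dec = e := fun e he =>
    image_image_of_leftInvOn hdc he
  have hC : C.image cod ⊆ X.image cod := image_subset_image hCX.1
  have hstr : strong α rel (C.image cod) (X.image cod) := by
    refine hdec.strong_of_image hC ?_
    rwa [himg C hCX.1, himg X subset_rfl]
  have hf' : IsEmb rel (relOf L ar V) (C.image cod) (f ∘ dec) :=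
    hf.comp (hdec.mono hC) (himg C hCX.1).subset
  obtain ⟨g, hg, hgf, hgm⟩ := exists_mStrong_extension har hα hmod m hr hstr hf' (by
    rwa [← image_image, himg C hCX.1])
  refine ⟨g ∘ cod, hg.comp hcod subset_rfl, fun x hx => ?_, ?_⟩
  · rw [Function.comp_apply, hgf _ (mem_image_of_mem cod hx), Function.comp_apply,
      hdc x (hCX.1 hx)]
  · rwa [← image_image]

end Extend

/-! ### Back and forth between strong sets -/

lemma IsEmb.exists_inverse {L S T : Type} [DecidableEq S] [DecidableEq T] [Nonempty S]
    {rel' : L → Finset S → Prop} {rel : L → Finset T → Prop} {C : Finset S} {f : S → T}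
    (hf : IsEmb rel' rel C f) :
    ∃ f', IsEmb rel rel' (C.image f) f' ∧ ∀ c ∈ C, f' (f c) = c := by
  have hinv : ∀ c ∈ C, Function.invFunOn f ↑C (f c) = c := fun c hc =>
    hf.1.leftInvOn_invFunOn (mem_coe.2 hc)
  refine ⟨Function.invFunOn f ↑C, ⟨?_, fun E e he => ?_⟩, hinv⟩
  · intro x hx y hy h
    obtain ⟨a, ha, rfl⟩ := mem_image.1 (mem_coe.1 hx)
    obtain ⟨b, hb, rfl⟩ := mem_image.1 (mem_coe.1 hy)
    rw [hinv a ha, hinv b hb] at h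
    rw [h]
  · obtain ⟨d, hd, rfl⟩ := exists_image_eq he
    rw [image_image_of_leftInvOn hinv hd, hf.2 E d hd]

section Terms

variable {L : Type} {ar : L → ℕ} {V : Type} [(hypLang L ar).Structure V]

lemma realize_term_comp {β : Type} (t : (hypLang L ar).Term β) (v : β → V) (f : V → V) :
    t.realize (f ∘ v) = f (t.realize v) := by
  cases t with
  | var i => rfl
  | func F _ => exact F.elim

lemma realize_term_mem {β : Type} (t : (hypLang L ar).Term β) {v : β → V} {C : Finset V}
    (h : ∀ i, v i ∈ C) : t.realize v ∈ C := by
  cases t with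
  | var i => exact h i
  | func F _ => exact F.elim

end Terms

section BackAndForth

variable {L : Type} [Fintype L] [Nonempty L] {ar : L → ℕ} {α : L → ℝ} {V : Type} [DecidableEq V]
  [(hypLang L ar).Structure V]

lemma exists_back_and_forth_step (har : ∀ E, 2 ≤ ar E) (hα : ∀ E, 0 < α E ∧ α E ≤ 1)
    (hmod : modelsSalpha L ar α V) (m : ℕ) :
    ∃ m', ∀ (C : Finset V) (f : V → V), IsEmb (relOf L ar V) (relOf L ar V) C f →
      (∀ F, mStrong α (relOf L ar V) m' C F) →
      (∀ F, mStrong α (relOf L ar V) m' (C.image f) F) → ∀ c, ∃ X g, insert c C ⊆ X ∧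
        IsEmb (relOf L ar V) (relOf L ar V) X g ∧ (∀ x ∈ C, g x = f x) ∧
        (∀ F, mStrong α (relOf L ar V) m X F) ∧
        ∀ F, mStrong α (relOf L ar V) m (X.image g) F := by
  have hα' : ∀ E, 0 ≤ α E := fun E => (hα E).1.le
  obtain ⟨θ, hθ, hcl⟩ := exists_closure (fun E => (hα E).1) m
  obtain ⟨B, hB⟩ := exists_nat_ge (1 / θ + m)
  refine ⟨max m (B + 1), fun C f hf hC hfC c => ?_⟩
  have hsd : ∀ Y, #(Y \ C) ≤ #(Y \ insert c C) + 1 := fun Y => by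
    have : Y \ C ⊆ insert c (Y \ insert c C) := fun x hx => by
      simp only [mem_sdiff, mem_insert] at hx ⊢
      tauto
    exact (card_le_card this).trans (card_insert_le _ _)
  have hins : delta α (relOf L ar V) (insert c C) ≤ delta α (relOf L ar V) C + 1 := by
    have h1 := delta_union_add_inter_le (rel := relOf L ar V) hα' {c} C
    have h2 := hmod.2.1 _ ({c} ∩ C) subset_rfl
    rw [delta_singleton (fun E e => relOf_card) har, singleton_union] at h1
    linarith
  have hY : ∀ Y, C ⊆ Y → #(Y \ C) ≤ B + 1 →
      delta α (relOf L ar V) C ≤ delta α (relOf L ar V) Y := fun Y h1 h2 =>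
    hC Y Y h1 subset_rfl (h2.trans (le_max_right _ _))
  obtain ⟨X, hX, hXm, hcard, -⟩ := hcl (relOf L ar V) (insert c C) B 1 hB fun Y h1 h2 => by
    have := hY Y ((subset_insert _ _).trans h1) ((hsd Y).trans (by omega))
    linarith
  have hCX : C ⊆ X := (subset_insert _ _).trans hX
  have : Nonempty V := ⟨c⟩
  obtain ⟨g, hg, hgf, hgm⟩ := exists_mStrong_extension_of_strong har hα hmod m (C := C) (X := X)
    ⟨hCX, fun D h1 h2 => hY D h1 ((card_le_card (sdiff_subset_sdiff h2 subset_rfl)).trans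
      ((hsd X).trans (by omega)))⟩ hf fun F => (hfC F).mono (le_max_left _ _)
  exact ⟨X, g, hX, hg, hgf, hXm, hgm⟩

/-- Every formula is preserved by isomorphisms between sets that are strong up to sufficiently
many points. -/
theorem exists_realize_comp_iff (har : ∀ E, 2 ≤ ar E) (hα : ∀ E, 0 < α E ∧ α E ≤ 1)
    (hmod : modelsSalpha L ar α V) {β : Type} {l : ℕ} (φ : (hypLang L ar).BoundedFormula β l) :
    ∃ m, ∀ (C : Finset V) (f : V → V), IsEmb (relOf L ar V) (relOf L ar V) C f →
      (∀ F, mStrong α (relOf L ar V) m C F) →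
      (∀ F, mStrong α (relOf L ar V) m (C.image f) F) →
      ∀ (v : β → V) (xs : Fin l → V), (∀ i, v i ∈ C) → (∀ i, xs i ∈ C) →
        (φ.Realize (f ∘ v) (f ∘ xs) ↔ φ.Realize v xs) := by
  have helim : ∀ {l : ℕ} (v : β → V) (xs : Fin l → V) (f : V → V),
      Sum.elim (f ∘ v) (f ∘ xs) = f ∘ Sum.elim v xs := fun v xs f => by
    funext i
    cases i <;> rfl
  have hmem : ∀ {l : ℕ} {v : β → V} {xs : Fin l → V} {C : Finset V}, (∀ i, v i ∈ C) →
      (∀ i, xs i ∈ C) → ∀ i, Sum.elim v xs i ∈ C := fun hv hx i => by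
    cases i
    exacts [hv _, hx _]
  induction φ with
  | falsum => exact ⟨0, fun _ _ _ _ _ _ _ _ _ => Iff.rfl⟩
  | equal t u =>
    refine ⟨0, fun C f hf _ _ v xs hv hx => ?_⟩
    simp only [BoundedFormula.Realize, helim, realize_term_comp]
    exact hf.1.eq_iff (realize_term_mem t (hmem hv hx)) (realize_term_mem u (hmem hv hx))
  | rel R ts =>
    refine ⟨0, fun C f hf _ _ v xs hv hx => ?_⟩
    obtain ⟨E, rfl⟩ := R
    have hin : ∀ i, (ts i).realize (Sum.elim v xs) ∈ C := fun i =>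
      realize_term_mem _ (hmem hv hx)
    simp only [BoundedFormula.Realize, helim, realize_term_comp]
    rw [relMap_iff hmod.1, relMap_iff hmod.1, hf.2 E (univ.image _) (image_subset_iff.2
      fun i _ => hin i), image_image]
    refine and_congr_left fun _ => ⟨fun h i j hij => h (congrArg f hij), fun h i j hij =>
      h (hf.1 (hin i) (hin j) hij)⟩
  | imp φ ψ ihφ ihψ =>
    obtain ⟨m₁, h₁⟩ := ihφ
    obtain ⟨m₂, h₂⟩ := ihψ
    refine ⟨max m₁ m₂, fun C f hf hC hfC v xs hv hx => ?_⟩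
    simp only [BoundedFormula.realize_imp]
    rw [h₁ C f hf (fun F => (hC F).mono (le_max_left _ _))
      (fun F => (hfC F).mono (le_max_left _ _)) v xs hv hx,
      h₂ C f hf (fun F => (hC F).mono (le_max_right _ _))
      (fun F => (hfC F).mono (le_max_right _ _)) v xs hv hx]
  | all φ ih =>
    obtain ⟨m, h⟩ := ih
    obtain ⟨m', hm'⟩ := exists_back_and_forth_step har hα hmod m
    have key : ∀ (C : Finset V) (f : V → V), IsEmb (relOf L ar V) (relOf L ar V) C f →
        (∀ F, mStrong α (relOf L ar V) m' C F) →
        (∀ F, mStrong α (relOf L ar V) m' (C.image f) F) →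
        ∀ (v : β → V) xs, (∀ i, v i ∈ C) → (∀ i, xs i ∈ C) →
          φ.all.Realize (f ∘ v) (f ∘ xs) → φ.all.Realize v xs := by
      intro C f hf hC hfC v xs hv hx hall
      rw [BoundedFormula.realize_all] at hall ⊢
      intro c
      obtain ⟨X, g, hX, hg, hgf, hXm, hgm⟩ := hm' C f hf hC hfC c
      have hc : c ∈ X := hX (mem_insert_self _ _)
      have hCX : C ⊆ X := (subset_insert _ _).trans hX
      have hgv : g ∘ v = f ∘ v := funext fun i => hgf _ (hv i)
      have hgx : g ∘ xs = f ∘ xs := funext fun i => hgf _ (hx i)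
      have := h X g hg hXm hgm v (Fin.snoc xs c) (fun i => hCX (hv i)) fun i => by
        refine Fin.lastCases ?_ (fun i => ?_) i
        · simpa using hc
        · simpa using hCX (hx i)
      rw [← this, Fin.comp_snoc, hgv, hgx]
      exact hall _
    refine ⟨m', fun C f hf hC hfC v xs hv hx => ⟨key C f hf hC hfC v xs hv hx, fun hall => ?_⟩⟩
    by_cases hV : Nonempty V
    · obtain ⟨f', hf', hinv⟩ := hf.exists_inverse
      refine key (C.image f) f' hf' hfC ?_ _ _ (fun i => mem_image_of_mem f (hv i))
        (fun i => mem_image_of_mem f (hx i)) ?_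
      · rwa [image_image_of_leftInvOn hinv subset_rfl]
      · have h1 : f' ∘ f ∘ v = v := funext fun i => hinv _ (hv i)
        have h2 : f' ∘ f ∘ xs = xs := funext fun i => hinv _ (hx i)
        rwa [h1, h2]
    · rw [BoundedFormula.realize_all]
      exact fun c => (hV ⟨c⟩).elim

end BackAndForth

section Diagram

variable {L : Type} [Fintype L] {ar : L → ℕ} {V : Type} [(hypLang L ar).Structure V]

/-- Some formula says that a tuple is contained in the image of an injective homomorphism
of `B`. -/
lemma exists_formula_realize_iff {n : ℕ} (B : Finset V) (b : Fin n → B) :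
    ∃ ψ : (hypLang L ar).Formula (Fin n), ∀ x : Fin n → V, ψ.Realize x ↔
      ∃ y : B → V, Function.Injective y ∧ (∀ i, y (b i) = x i) ∧
        ∀ E (τ : Fin (ar E) → B),
          @Structure.RelMap (hypLang L ar) V _ (ar E) ⟨E, rfl⟩ (fun i => (τ i : V)) →
          @Structure.RelMap (hypLang L ar) V _ (ar E) ⟨E, rfl⟩ (y ∘ τ) := by
  classical
  let v : Fin n ⊕ B → (hypLang L ar).Term (Fin n ⊕ B) := Term.var
  let χ₁ : (hypLang L ar).Formula (Fin n ⊕ B) :=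
    Formula.iInf fun p : B × B => if p.1 = p.2 then ⊤ else
      ((v (.inr p.1)).equal (v (.inr p.2))).not
  let χ₂ : (hypLang L ar).Formula (Fin n ⊕ B) :=
    Formula.iInf fun i : Fin n => (v (.inr (b i))).equal (v (.inl i))
  let χ₃ : (hypLang L ar).Formula (Fin n ⊕ B) :=
    Formula.iInf fun p : Σ E, Fin (ar E) → B =>
      if @Structure.RelMap (hypLang L ar) V _ (ar p.1) ⟨p.1, rfl⟩ (fun i => (p.2 i : V)) then
        Relations.formula (L := hypLang L ar) (n := ar p.1) ⟨p.1, rfl⟩ fun i => v (.inr (p.2 i))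
      else ⊤
  refine ⟨Formula.iExs B (χ₁ ⊓ (χ₂ ⊓ χ₃)), fun x => ?_⟩
  rw [Formula.realize_iExs]
  refine exists_congr fun y => ?_
  rw [Formula.realize_inf, Formula.realize_inf]
  refine and_congr ?_ (and_congr ?_ ?_)
  · rw [Formula.realize_iInf]
    constructor
    · intro h i j hij
      by_contra hne
      have := h (i, j)
      simp [hne, v, Formula.realize_equal, hij] at this
    · rintro h ⟨i, j⟩
      by_cases hij : i = j
      · simp [hij]
      · simpa [hij, v, Formula.realize_equal] using fun h' => hij (h h')
  · rw [Formula.realize_iInf]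
    simp [v, Formula.realize_equal]
  · rw [Formula.realize_iInf]
    constructor
    · intro h E τ hτ
      have := h ⟨E, τ⟩
      rw [if_pos hτ] at this
      exact Formula.realize_rel.1 this
    · rintro h ⟨E, τ⟩
      by_cases hτ : @Structure.RelMap (hypLang L ar) V _ (ar E) ⟨E, rfl⟩ (fun i => (τ i : V))
      · rw [if_pos hτ]
        exact Formula.realize_rel.2 (h E τ hτ)
      · rw [if_neg hτ]
        simp

end Diagram

/-- Any finite subset of a model has a copy that is strong up to `m` points and lies in a set of
small rank. -/
lemma exists_copy_delta_le {L : Type} [Fintype L] [Nonempty L] {ar : L → ℕ} {α : L → ℝ}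
    {V : Type} [DecidableEq V] [(hypLang L ar).Structure V] [Nonempty V]
    (har : ∀ E, 2 ≤ ar E) (hα : ∀ E, 0 < α E ∧ α E ≤ 1) (hmod : modelsSalpha L ar α V) (m : ℕ)
    (A : Finset V) {η : ℝ} (hη : 0 < η) :
    ∃ (f : V → V) (B : Finset V), IsEmb (relOf L ar V) (relOf L ar V) A f ∧ A.image f ⊆ B ∧
      (∀ F, mStrong α (relOf L ar V) m (A.image f) F) ∧ delta α (relOf L ar V) B ≤ η := by
  have hpos : ∀ D, 0 ≤ delta α (relOf L ar V) D := fun D => hmod.2.1 D D subset_rfl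
  obtain ⟨cod, dec, rel, hdc, hr, hdec, hcod⟩ :=
    exists_encoding (ar := ar) (rel := relOf L ar V) (fun E e => relOf_card) A
  obtain ⟨rel', C, hext, hd⟩ := exists_ext_delta_le har hα m hη hr (A := ∅) (C := A.image cod)
    ⟨empty_subset _, fun D _ hD => by
      rw [delta_empty hr har, ← hdec.delta_image hD]
      exact hpos _⟩
  obtain ⟨g, hg, -, hgm⟩ := exists_mStrong_extension har hα hmod m hext.card_eq hext.strong
    (f := fun _ => Classical.arbitrary V)
    ⟨by simp, fun E e he => by
      rw [subset_empty.1 he, image_empty]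
      exact iff_of_false
        (fun h => (Nat.zero_lt_two.trans_le (har E)).ne (hext.card_eq E _ h))
        (fun h => (Nat.zero_lt_two.trans_le (har E)).ne (relOf_card h))⟩
    (fun F D _ _ _ => by
      rw [image_empty, delta_empty (fun E e => relOf_card) har]
      exact hpos _)
  have hgA : IsEmb rel (relOf L ar V) (A.image cod) g :=
    ⟨hg.1.mono (by exact_mod_cast hext.subset), fun E e he => by
      rw [← hext.rel_iff E e he, hg.2 E e (he.trans hext.subset)]⟩
  have hsub : A.image (g ∘ cod) ⊆ C.image g := by
    rw [← image_image]
    exact image_subset_image hext.subset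
  refine ⟨g ∘ cod, C.image g, hgA.comp hcod subset_rfl, hsub, fun F => ?_, ?_⟩
  · have himg : mStrong α (relOf L ar V) m (A.image (g ∘ cod)) (C.image g) := by
      rw [← image_image]
      exact hg.mStrong_image hext.subset hext.mStrong
    exact fun D h1 h2 => (himg.trans (fun E => (hα E).1.le) hsub subset_union_left
      (hgm (C.image g ∪ F))) D h1 (h2.trans subset_union_right)
  · rwa [hg.delta_image subset_rfl, ← zero_add η, ← delta_empty hext.card_eq har (α := α)]

/-- In an atomic model `M` of `S_α`, a finite substructure `A` is strong in `M`
iff `δ(A) = 0`. -/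
theorem stmt17 {L : Type} [Fintype L] [Nonempty L] (ar : L → ℕ)
    (har : ∀ E, 2 ≤ ar E) (α : L → ℝ) (hα : ∀ E, 0 < α E ∧ α E ≤ 1)
    (V : Type) [DecidableEq V] [(hypLang L ar).Structure V]
    (hmod : modelsSalpha L ar α V) (hat : atomicModel L ar α V)
    (A : Finset V) :
    (∀ F : Finset V, A ⊆ F → strong α (relOf L ar V) A F) ↔
      delta α (relOf L ar V) A = 0 := by
  have hpos : ∀ D, 0 ≤ delta α (relOf L ar V) D := fun D => hmod.2.1 D D subset_rfl
  refine ⟨fun hA => ?_, fun h F hF => ⟨hF, fun D _ _ => h ▸ hpos D⟩⟩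
  by_contra hne
  have hδ : 0 < delta α (relOf L ar V) A := lt_of_le_of_ne (hpos A) (Ne.symm hne)
  have : Nonempty V := by
    by_contra hV
    have : A = ∅ := eq_empty_of_forall_notMem fun x _ => hV ⟨x⟩
    exact hne (this ▸ delta_empty (fun E e => relOf_card) har)
  let a : Fin #A → V := fun i => A.equivFin.symm i
  have ha : ∀ i, a i ∈ A := fun i => (A.equivFin.symm i).2
  obtain ⟨φ, hφ, hiso⟩ := hat #A a
  obtain ⟨m, hm⟩ := exists_realize_comp_iff har hα hmod φ
  obtain ⟨f, B, hf, hAB, hfm, hB⟩ := exists_copy_delta_le har hα hmod m A (half_pos hδ)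
  have hAm : ∀ F, mStrong α (relOf L ar V) m A F := fun F D h1 _ _ =>
    (hA D h1).2 D h1 subset_rfl
  have hφf : φ.Realize (f ∘ a) := by
    have := (hm A f hf hAm hfm a default ha fun i => i.elim0).2 hφ
    rwa [Subsingleton.elim (f ∘ default) default] at this
  have hfB : ∀ i, f (a i) ∈ B := fun i => hAB (mem_image_of_mem f (ha i))
  obtain ⟨ψ, hψ⟩ := exists_formula_realize_iff (ar := ar) B fun i => ⟨f (a i), hfB i⟩
  refine hiso ψ.not ?_ V hmod _ hφf ((hψ _).2 ⟨Subtype.val, Subtype.val_injective,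
    fun i => rfl, fun E τ h => h⟩)
  rw [Formula.realize_not, hψ]
  rintro ⟨y, hy, hya, hyE⟩
  let g : V → V := fun x => if h : x ∈ B then y ⟨x, h⟩ else x
  have hg : ∀ x : B, g x = y x := fun x => by simp [g]
  have hginj : Set.InjOn g ↑B := fun x hx z hz h => by
    have := hy ((hg ⟨x, hx⟩).symm.trans (h.trans (hg ⟨z, hz⟩)))
    exact congrArg Subtype.val this
  have hle := delta_image_le (rel := relOf L ar V) (rel' := relOf L ar V)
    (fun E => (hα E).1.le) hginj fun E e he h => by
    obtain ⟨x, hx, rfl, hR⟩ := h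
    have hxB : ∀ i, x i ∈ B := fun i => he (mem_image_of_mem x (mem_univ i))
    have := hyE E (fun i => ⟨x i, hxB i⟩) hR
    refine ⟨g ∘ x, fun i j h => hx (hginj (hxB i) (hxB j) h), image_image.symm, ?_⟩
    convert this using 1
    funext i
    exact hg ⟨x i, hxB i⟩
  have hAsub : A ⊆ B.image g := fun x hx => by
    refine mem_image.2 ⟨f x, hAB (mem_image_of_mem f hx), ?_⟩
    have h1 : a (A.equivFin ⟨x, hx⟩) = x := by simp [a]
    have h2 : g (f (a (A.equivFin ⟨x, hx⟩))) = a (A.equivFin ⟨x, hx⟩) := (hg _).trans (hya _)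
    rwa [h1] at h2
  have := (hA _ hAsub).2 _ hAsub subset_rfl
  linarith
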